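/- Under mean curvature flow of a submanifold with flat normal bundle, the squared second fundamental form satisfies d/dt|A|² = Δ|A|² − 2|∇^⊥A|² + 2|A^{αm}_n A^{βn}_m|² ≤ Δ|A|² − 2|∇^⊥A|² + 2|A|⁴. -/

import Mathlib

noncomputable section

open Real Finset

/-- Partial derivative of a scalar function on `ℝ^m` in direction `i`. -/
def pd {m : ℕ} (f : (Fin m → ℝ) → ℝ) (i : Fin m) (x : Fin m → ℝ) : ℝ :=
  fderiv ℝ f x (Pi.single i 1)

/-- Components `F^α_i` of the differential of an immersion `F : ℝ^m → ℝ^n`. -/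
def Fd {m n : ℕ} (F : (Fin m → ℝ) → (Fin n → ℝ)) (α : Fin n) (i : Fin m)
    (x : Fin m → ℝ) : ℝ :=
  pd (fun y => F y α) i x

/-- Induced metric `g_{ij} = ⟨F_i, F_j⟩`. -/
def gInd {m n : ℕ} (F : (Fin m → ℝ) → (Fin n → ℝ)) (i j : Fin m) (x : Fin m → ℝ) : ℝ :=
  ∑ α, Fd F α i x * Fd F α j x

/-- Induced metric as a matrix. -/
def gMat {m n : ℕ} (F : (Fin m → ℝ) → (Fin n → ℝ)) (x : Fin m → ℝ) :
    Matrix (Fin m) (Fin m) ℝ :=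
  fun i j => gInd F i j x

/-- Inverse metric `g^{ij}`. -/
def gInv {m n : ℕ} (F : (Fin m → ℝ) → (Fin n → ℝ)) (i j : Fin m) (x : Fin m → ℝ) : ℝ :=
  (gMat F x)⁻¹ i j

/-- Christoffel symbols `Γ^k_{ij}` of the induced metric. -/
def chr {m n : ℕ} (F : (Fin m → ℝ) → (Fin n → ℝ)) (k i j : Fin m) (x : Fin m → ℝ) : ℝ :=
  (1/2) * ∑ l, gInv F k l x *
    (pd (gInd F l j) i x + pd (gInd F l i) j x - pd (gInd F i j) l x)

/-- Second fundamental form `A^α_{ij} = F^α_{ij} - Γ^k_{ij} F^α_k`. -/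
def sff {m n : ℕ} (F : (Fin m → ℝ) → (Fin n → ℝ)) (α : Fin n) (i j : Fin m)
    (x : Fin m → ℝ) : ℝ :=
  pd (fun y => Fd F α j y) i x - ∑ k, chr F k i j x * Fd F α k x

/-- Mean curvature vector `H^α = g^{ij} A^α_{ij}`. -/
def mcv {m n : ℕ} (F : (Fin m → ℝ) → (Fin n → ℝ)) (α : Fin n) (x : Fin m → ℝ) : ℝ :=
  ∑ i, ∑ j, gInv F i j x * sff F α i j x

/-- Riemann curvature tensor `R^l_{kij}` of the induced metric. -/
def riem {m n : ℕ} (F : (Fin m → ℝ) → (Fin n → ℝ)) (l k i j : Fin m) (x : Fin m → ℝ) : ℝ :=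
  pd (fun y => chr F l j k y) i x - pd (fun y => chr F l i k y) j x
    + ∑ p, (chr F l i p x * chr F p j k x - chr F l j p x * chr F p i k x)

/-- Riemann curvature tensor with all indices lowered, `R_{ijkl} = g_{ip} R^p_{jkl}`. -/
def riemLow {m n : ℕ} (F : (Fin m → ℝ) → (Fin n → ℝ)) (i j k l : Fin m) (x : Fin m → ℝ) : ℝ :=
  ∑ p, gInd F i p x * riem F p j k l x

/-- Ricci curvature `R_{ij} = R^k_{ikj}` of the induced metric. -/
def ricci {m n : ℕ} (F : (Fin m → ℝ) → (Fin n → ℝ)) (i j : Fin m) (x : Fin m → ℝ) : ℝ :=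
  ∑ k, riem F k i k j x

/-- Tangential projector `T^α_β = g^{ij} F^α_i F^β_j` onto the tangent space. -/
def tanP {m n : ℕ} (F : (Fin m → ℝ) → (Fin n → ℝ)) (α β : Fin n) (x : Fin m → ℝ) : ℝ :=
  ∑ i, ∑ j, gInv F i j x * Fd F α i x * Fd F β j x

/-- Normal projector `N = id - T` onto the normal bundle. -/
def norP {m n : ℕ} (F : (Fin m → ℝ) → (Fin n → ℝ)) (α β : Fin n) (x : Fin m → ℝ) : ℝ :=
  (if α = β then 1 else 0) - tanP F α β x

/-- Derivative of the normal projector. -/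
def dnorP {m n : ℕ} (F : (Fin m → ℝ) → (Fin n → ℝ)) (i : Fin m) (α β : Fin n)
    (x : Fin m → ℝ) : ℝ :=
  pd (fun y => norP F α β y) i x

/-- Curvature `R^{αβ}_{ij}` of the normal connection (the connection `N ∘ d` on the
normal bundle `im N`), given by the standard formula `N (∂_i N ∂_j N - ∂_j N ∂_i N) N`. -/
def normCurv {m n : ℕ} (F : (Fin m → ℝ) → (Fin n → ℝ)) (α β : Fin n) (i j : Fin m)
    (x : Fin m → ℝ) : ℝ :=
  ∑ γ, ∑ δ, ∑ ε,
    norP F α γ x * (dnorP F i γ δ x * dnorP F j δ ε x - dnorP F j γ δ x * dnorP F i δ ε x)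
      * norP F ε β x

/-- Covariant derivative `∇_l A^α_{ij}` of the second fundamental form, using the full
induced connection (the pullback connection on `F⁻¹Tℝⁿ` is flat in cartesian coordinates). -/
def covA {m n : ℕ} (F : (Fin m → ℝ) → (Fin n → ℝ)) (l : Fin m) (α : Fin n) (i j : Fin m)
    (x : Fin m → ℝ) : ℝ :=
  pd (fun y => sff F α i j y) l x - ∑ k, chr F k l i x * sff F α k j x
    - ∑ k, chr F k l j x * sff F α i k x

/-- Second covariant derivative `∇_p ∇_l A^α_{ij}`. -/
def cov2A {m n : ℕ} (F : (Fin m → ℝ) → (Fin n → ℝ)) (p l : Fin m) (α : Fin n) (i j : Fin m)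
    (x : Fin m → ℝ) : ℝ :=
  pd (fun y => covA F l α i j y) p x - ∑ k, chr F k p l x * covA F k α i j x
    - ∑ k, chr F k p i x * covA F l α k j x - ∑ k, chr F k p j x * covA F l α i k x

/-- Covariant Hessian `∇_l ∇_k H^α` of the mean curvature vector. -/
def hessH {m n : ℕ} (F : (Fin m → ℝ) → (Fin n → ℝ)) (α : Fin n) (l k : Fin m)
    (x : Fin m → ℝ) : ℝ :=
  pd (fun y => pd (fun z => mcv F α z) k y) l x - ∑ p, chr F p l k x * pd (fun z => mcv F α z) p x

/-- Covariant derivative `∇_l R_{ij}` of the Ricci tensor. -/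
def covRic {m n : ℕ} (F : (Fin m → ℝ) → (Fin n → ℝ)) (l i j : Fin m) (x : Fin m → ℝ) : ℝ :=
  pd (fun y => ricci F i j y) l x - ∑ p, chr F p l i x * ricci F p j x
    - ∑ p, chr F p l j x * ricci F i p x

/-- The tensor `a_{ij} = g_{αβ} H^α A^β_{ij}`. -/
def aT {m n : ℕ} (F : (Fin m → ℝ) → (Fin n → ℝ)) (i j : Fin m) (x : Fin m → ℝ) : ℝ :=
  ∑ α, mcv F α x * sff F α i j x

/-- The tensor `b_{ij} = g_{αβ} A^α_{ik} A^{βk}_j`. -/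
def bT {m n : ℕ} (F : (Fin m → ℝ) → (Fin n → ℝ)) (i j : Fin m) (x : Fin m → ℝ) : ℝ :=
  ∑ α, ∑ k, ∑ l, gInv F k l x * sff F α i k x * sff F α j l x

/-- Squared norm `|H|²` of the mean curvature vector. -/
def normH2 {m n : ℕ} (F : (Fin m → ℝ) → (Fin n → ℝ)) (x : Fin m → ℝ) : ℝ :=
  ∑ α, (mcv F α x) ^ 2

/-- Squared norm `|A|²` of the second fundamental form. -/
def normA2 {m n : ℕ} (F : (Fin m → ℝ) → (Fin n → ℝ)) (x : Fin m → ℝ) : ℝ :=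
  ∑ α, ∑ i, ∑ j, ∑ k, ∑ l,
    gInv F i k x * gInv F j l x * sff F α i j x * sff F α k l x

/-- Squared norm `|a_{ij}|²`. -/
def normaT2 {m n : ℕ} (F : (Fin m → ℝ) → (Fin n → ℝ)) (x : Fin m → ℝ) : ℝ :=
  ∑ i, ∑ j, ∑ k, ∑ l, gInv F i k x * gInv F j l x * aT F i j x * aT F k l x

/-- Components `∇_i H^α + a_i^l F^α_l` of the normal covariant derivative of `H`. -/
def nperpH {m n : ℕ} (F : (Fin m → ℝ) → (Fin n → ℝ)) (i : Fin m) (α : Fin n)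
    (x : Fin m → ℝ) : ℝ :=
  pd (fun y => mcv F α y) i x + ∑ l, ∑ k, gInv F l k x * aT F i k x * Fd F α l x

/-- Squared norm `|∇^⊥ H|²`. -/
def normNperpH2 {m n : ℕ} (F : (Fin m → ℝ) → (Fin n → ℝ)) (x : Fin m → ℝ) : ℝ :=
  ∑ α, ∑ i, ∑ j, gInv F i j x * nperpH F i α x * nperpH F j α x

/-- Components `∇_l A^α_{ij} + A^β_{ij} A^k_{βl} F^α_k` of the normal covariant
derivative of `A`. -/
def nperpA {m n : ℕ} (F : (Fin m → ℝ) → (Fin n → ℝ)) (l : Fin m) (α : Fin n) (i j : Fin m)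
    (x : Fin m → ℝ) : ℝ :=
  covA F l α i j x + ∑ β, ∑ k, ∑ p, sff F β i j x * gInv F k p x * sff F β p l x * Fd F α k x

/-- Squared norm `|∇^⊥ A|²`. -/
def normNperpA2 {m n : ℕ} (F : (Fin m → ℝ) → (Fin n → ℝ)) (x : Fin m → ℝ) : ℝ :=
  ∑ α, ∑ l, ∑ l', ∑ i, ∑ i', ∑ j, ∑ j',
    gInv F l l' x * gInv F i i' x * gInv F j j' x * nperpA F l α i j x * nperpA F l' α i' j' x

/-- The symmetric bilinear form `S^{αβ} = A^{αm}_n A^{βn}_m` on the normal bundle. -/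
def ssf {m n : ℕ} (F : (Fin m → ℝ) → (Fin n → ℝ)) (α β : Fin n) (x : Fin m → ℝ) : ℝ :=
  ∑ i, ∑ j, (∑ k, gInv F i k x * sff F α k j x) * (∑ p, gInv F j p x * sff F β p i x)

/-- Squared norm `|A^{αm}_n A^{βn}_m|²`. -/
def normSsf2 {m n : ℕ} (F : (Fin m → ℝ) → (Fin n → ℝ)) (x : Fin m → ℝ) : ℝ :=
  ∑ α, ∑ β, (ssf F α β x) ^ 2

/-- Squared norm `|R^⊥|²` of the normal curvature. -/
def normRperp2 {m n : ℕ} (F : (Fin m → ℝ) → (Fin n → ℝ)) (x : Fin m → ℝ) : ℝ :=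
  ∑ α, ∑ β, ∑ i, ∑ j, ∑ k, ∑ l,
    gInv F i k x * gInv F j l x * normCurv F α β i j x * normCurv F α β k l x

/-- Riemannian volume density `√(det g)`. -/
def volDens {m n : ℕ} (F : (Fin m → ℝ) → (Fin n → ℝ)) (x : Fin m → ℝ) : ℝ :=
  Real.sqrt (gMat F x).det

/-- Laplace–Beltrami operator on scalar functions, `Δf = g^{ij}(∂_i∂_j f - Γ^k_{ij} ∂_k f)`. -/
def lapBel {m n : ℕ} (F : (Fin m → ℝ) → (Fin n → ℝ)) (f : (Fin m → ℝ) → ℝ)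
    (x : Fin m → ℝ) : ℝ :=
  ∑ i, ∑ j, gInv F i j x * (pd (fun y => pd f i y) j x - ∑ k, chr F k i j x * pd f k x)

section Core

/-- Tangential calculus on a submanifold of Euclidean space, written over a ring of functions:
`T` is the tangential projector, `D β` the tangential derivative in the ambient direction `β` and
`a` the second fundamental form, with all indices ambient. -/
structure TangentialCalculus (k R ι : Type*) [CommRing k] [CommRing R] [Algebra k R]
    [Fintype ι] where
  D : ι → Derivation k R R
  T : ι → ι → R
  a : ι → ι → ι → R
  T_symm : ∀ α β, T α β = T β α
  D_T : ∀ γ α β, D γ (T α β) = a α γ β + a β γ α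
  a_symm : ∀ α β γ, a α β γ = a α γ β
  T_a_fst : ∀ α β γ, ∑ κ, T α κ * a κ β γ = 0
  T_a_snd : ∀ α β γ, ∑ κ, T β κ * a α κ γ = a α β γ
  T_D : ∀ β f, ∑ κ, T β κ * D κ f = D β f
  D_comm : ∀ β γ f, D β (D γ f) - D γ (D β f) = ∑ δ, (a γ β δ - a β γ δ) * D δ f

namespace TangentialCalculus

variable {k R ι : Type*} [CommRing k] [CommRing R] [Algebra k R] [Fintype ι]
  (C : TangentialCalculus k R ι)

/-- Normal covariant derivative of the second fundamental form. -/
def c (δ α β γ : ι) : R :=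
  C.D δ (C.a α β γ) + ∑ ε, C.a ε δ α * C.a ε β γ - ∑ ε, C.a β δ ε * C.a α ε γ
    - ∑ ε, C.a γ δ ε * C.a α β ε

/-- Mean curvature vector. -/
def H (α : ι) : R := ∑ β, C.a α β β

/-- Normal derivative of the mean curvature vector. -/
def W (α γ : ι) : R := C.D γ (C.H α) + ∑ ε, C.a ε γ α * C.H ε

lemma T_a_trd (α β γ : ι) : ∑ κ, C.T γ κ * C.a α β κ = C.a α β γ := by
  simp only [C.a_symm α β]
  exact C.T_a_snd α γ β

/-- A tangential index paired with a normal one. -/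
lemma sum_mul_eq_zero {x y : ι → R} (hx : ∀ κ, ∑ α, C.T κ α * x α = x κ)
    (hy : ∀ κ, ∑ α, C.T κ α * y α = 0) : ∑ α, x α * y α = 0 := by
  calc ∑ α, x α * y α = ∑ α, ∑ κ, C.T α κ * x κ * y α :=
        sum_congr rfl fun α _ => by rw [← sum_mul, hx]
    _ = ∑ κ, ∑ α, C.T α κ * x κ * y α := sum_comm
    _ = ∑ κ, x κ * ∑ α, C.T κ α * y α :=
        sum_congr rfl fun κ _ => by
          rw [mul_sum]
          exact sum_congr rfl fun α _ => by rw [C.T_symm α κ]; ring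
    _ = 0 := by simp [hy]

/-- A tangential index only sees the tangential part. -/
lemma sum_mul_T {x : ι → R} (hx : ∀ κ, ∑ α, C.T κ α * x α = x κ) (y : ι → R) :
    ∑ α, x α * y α = ∑ κ, x κ * ∑ α, C.T κ α * y α := by
  calc ∑ α, x α * y α = ∑ α, ∑ κ, C.T α κ * x κ * y α :=
        sum_congr rfl fun α _ => by rw [← sum_mul, hx]
    _ = ∑ κ, ∑ α, C.T α κ * x κ * y α := sum_comm
    _ = ∑ κ, x κ * ∑ α, C.T κ α * y α :=
        sum_congr rfl fun κ _ => by
          rw [mul_sum]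
          exact sum_congr rfl fun α _ => by rw [C.T_symm α κ]; ring

lemma a_snd_a_fst (α γ μ ν : ι) : ∑ β, C.a α β γ * C.a β μ ν = 0 :=
  C.sum_mul_eq_zero (fun κ => C.T_a_snd α κ γ) (fun κ => C.T_a_fst κ μ ν)

lemma a_trd_a_fst (α γ μ ν : ι) : ∑ β, C.a α γ β * C.a β μ ν = 0 :=
  C.sum_mul_eq_zero (fun κ => C.T_a_trd α γ κ) (fun κ => C.T_a_fst κ μ ν)

lemma a_fst_D (μ ν : ι) (f : R) : ∑ β, C.a β μ ν * C.D β f = 0 := by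
  simp only [mul_comm (C.a _ μ ν)]
  exact C.sum_mul_eq_zero (fun κ => C.T_D κ f) (fun κ => C.T_a_fst κ μ ν)

lemma T_Da_fst (κ δ β γ : ι) :
    ∑ α, C.T κ α * C.D δ (C.a α β γ) = - ∑ ε, C.a ε δ κ * C.a ε β γ := by
  have h := congrArg (C.D δ) (C.T_a_fst κ β γ)
  simp only [map_sum, Derivation.leibniz, map_zero, smul_eq_mul, C.D_T, mul_add,
    sum_add_distrib] at h
  have h2 := C.a_trd_a_fst κ δ β γ
  simp only [mul_comm (C.a _ β γ)] at h
  linear_combination h - h2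

lemma T_Da_snd (κ δ α γ : ι) :
    ∑ β, C.T κ β * C.D δ (C.a α β γ) = C.D δ (C.a α κ γ) - ∑ ε, C.a κ δ ε * C.a α ε γ := by
  have h := congrArg (C.D δ) (C.T_a_snd α κ γ)
  simp only [map_sum, Derivation.leibniz, smul_eq_mul, C.D_T, mul_add,
    sum_add_distrib] at h
  have h2 := C.a_snd_a_fst α γ δ κ
  simp only [mul_comm (C.a α _ γ)] at h h2
  linear_combination h - h2

lemma T_Da_trd (κ δ α β : ι) :
    ∑ γ, C.T κ γ * C.D δ (C.a α β γ) = C.D δ (C.a α β κ) - ∑ ε, C.a κ δ ε * C.a α β ε := by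
  simp only [C.a_symm α β]
  exact C.T_Da_snd κ δ α β

/-- Differentiating a normal index contracted against a tangential one. -/
lemma tangential_mul_Da_fst {x : ι → R} (hx : ∀ κ, ∑ α, C.T κ α * x α = x κ) (δ μ ν : ι) :
    ∑ γ, x γ * C.D δ (C.a γ μ ν) = - ∑ κ, ∑ ε, x κ * C.a ε δ κ * C.a ε μ ν := by
  rw [C.sum_mul_T hx, ← sum_neg_distrib]
  refine sum_congr rfl fun κ _ => ?_
  rw [C.T_Da_fst, mul_neg, mul_sum]
  simp only [mul_assoc]

/-- Differentiating a tangential index contracted against a normal one. -/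
lemma normal_mul_Da_snd {x : ι → R} (hx : ∀ κ, ∑ α, C.T κ α * x α = 0) (δ α γ : ι) :
    ∑ β, x β * C.D δ (C.a α β γ) = ∑ β, ∑ ε, x β * C.a β δ ε * C.a α ε γ := by
  have h : ∀ β, C.D δ (C.a α β γ) =
      ∑ ε, C.a β δ ε * C.a α ε γ + ∑ κ, C.T β κ * C.D δ (C.a α κ γ) := fun β => by
    rw [C.T_Da_snd]; ring
  have h0 : ∑ β, x β * ∑ κ, C.T β κ * C.D δ (C.a α κ γ) = 0 := by
    simp only [mul_sum]
    rw [sum_comm]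
    refine sum_eq_zero fun κ _ => ?_
    calc _ = (∑ β, C.T κ β * x β) * C.D δ (C.a α κ γ) := by
            rw [sum_mul]; exact sum_congr rfl fun β _ => by rw [C.T_symm β κ]; ring
      _ = 0 := by rw [hx, zero_mul]
  calc _ = ∑ β, x β * (∑ ε, C.a β δ ε * C.a α ε γ) := by
          rw [sum_congr rfl fun β _ => by rw [h β, mul_add], sum_add_distrib, h0, add_zero]
    _ = _ := sum_congr rfl fun β _ => by rw [mul_sum]; simp only [mul_assoc]

lemma c_symm (δ α β γ : ι) : C.c δ α β γ = C.c δ α γ β := by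
  simp only [c]
  rw [C.a_symm α β γ]
  simp only [C.a_symm _ β γ, C.a_symm α _ γ, C.a_symm α β]
  ring

lemma T_mul_sum (κ : ι) (x : ι → R) (y : ι → ι → R) :
    ∑ α, C.T κ α * ∑ ε, x ε * y ε α = ∑ ε, x ε * ∑ α, C.T κ α * y ε α := by
  simp only [mul_sum]
  rw [sum_comm]
  exact sum_congr rfl fun _ _ => sum_congr rfl fun _ _ => by ring

lemma T_mul_sum' (κ : ι) (x : ι → R) (y : ι → ι → R) :
    ∑ α, C.T κ α * ∑ ε, y ε α * x ε = ∑ ε, (∑ α, C.T κ α * y ε α) * x ε := by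
  simp only [mul_sum, sum_mul]
  rw [sum_comm]
  exact sum_congr rfl fun _ _ => sum_congr rfl fun _ _ => by ring

lemma T_c_snd (κ δ β γ : ι) : ∑ α, C.T κ α * C.c δ α β γ = 0 := by
  simp only [c, mul_sub, mul_add, sum_sub_distrib, sum_add_distrib]
  rw [C.T_Da_fst, C.T_mul_sum' κ _ (fun ε α => C.a ε δ α),
    C.T_mul_sum κ _ (fun ε α => C.a α ε γ), C.T_mul_sum κ _ (fun ε α => C.a α β ε)]
  simp only [C.T_a_trd, C.T_a_fst]
  simp

lemma T_c_frth (κ δ α β : ι) : ∑ γ, C.T κ γ * C.c δ α β γ = C.c δ α β κ := by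
  simp only [c, mul_sub, mul_add, sum_sub_distrib, sum_add_distrib]
  rw [C.T_Da_trd, C.T_mul_sum κ _ (fun ε α => C.a ε β α),
    C.T_mul_sum κ _ (fun ε γ => C.a α ε γ), C.T_mul_sum' κ _ (fun ε γ => C.a γ δ ε)]
  simp only [C.T_a_trd, C.T_a_fst]
  simp only [zero_mul, sum_const_zero]
  ring

lemma T_c_trd (κ δ α γ : ι) : ∑ β, C.T κ β * C.c δ α β γ = C.c δ α κ γ := by
  simp only [C.c_symm δ α _ γ]
  exact C.T_c_frth κ δ α γ

/-- Codazzi equation. -/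
lemma codazzi (δ α β γ : ι) : C.c δ α β γ = C.c β α δ γ := by
  have key : ∀ α γ, (C.c δ α β γ - C.c β α δ γ) + (C.c δ γ β α - C.c β γ δ α) = 0 := by
    intro α γ
    have h := C.D_comm δ β (C.T α γ)
    simp only [C.D_T, map_add, sub_mul, mul_add, sum_sub_distrib, sum_add_distrib] at h
    simp only [c]
    have e1 : ∀ δ β α γ, ∑ ε, C.a ε δ α * C.a ε β γ = ∑ ε, C.a ε β γ * C.a ε δ α :=
      fun δ β α γ => sum_congr rfl fun _ _ => mul_comm _ _
    have e2 : ∀ δ β α γ, ∑ ε, C.a γ δ ε * C.a α β ε = ∑ ε, C.a α β ε * C.a γ δ ε :=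
      fun δ β α γ => sum_congr rfl fun _ _ => mul_comm _ _
    linear_combination h + e1 δ β α γ + e1 δ β γ α + e2 β δ α γ + e2 β δ γ α
  have h1 : ∑ κ, C.T γ κ * ((C.c δ α β κ - C.c β α δ κ) + (C.c δ κ β α - C.c β κ δ α)) = 0 := by
    simp [key]
  simp only [mul_add, mul_sub, sum_add_distrib, sum_sub_distrib, C.T_c_frth, C.T_c_snd] at h1
  linear_combination h1
lemma T_c_fst (κ α β γ : ι) : ∑ δ, C.T κ δ * C.c δ α β γ = C.c κ α β γ := by
  simp only [C.codazzi _ α β γ]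
  rw [C.T_c_trd, C.codazzi]

lemma a_fst_fst (ε : ι) : ∑ δ, C.a δ δ ε = 0 := by
  calc ∑ δ, C.a δ δ ε = ∑ δ, ∑ κ, C.T δ κ * C.a δ κ ε :=
        sum_congr rfl fun δ _ => (C.T_a_snd δ δ ε).symm
    _ = ∑ κ, ∑ δ, C.T κ δ * C.a δ κ ε := by
        rw [sum_comm]
        exact sum_congr rfl fun κ _ => sum_congr rfl fun δ _ => by rw [C.T_symm]
    _ = 0 := by simp [C.T_a_fst]

lemma sum_c_diag (α γ : ι) : ∑ δ, C.c γ α δ δ = C.W α γ := by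
  simp only [c, W, H, sum_sub_distrib, sum_add_distrib, map_sum, mul_sum]
  have h1 : ∑ δ, ∑ ε, C.a δ γ ε * C.a α ε δ = 0 := by
    rw [sum_comm]
    refine sum_eq_zero fun ε _ => ?_
    rw [← C.a_trd_a_fst α ε γ ε]
    exact sum_congr rfl fun _ _ => mul_comm _ _
  have h2 : ∑ δ, ∑ ε, C.a δ γ ε * C.a α δ ε = 0 := by
    rw [← h1]
    exact sum_congr rfl fun δ _ => sum_congr rfl fun ε _ => by rw [C.a_symm α]
  rw [h1, h2, sum_comm]
  ring

lemma T_W_fst (κ γ : ι) : ∑ α, C.T κ α * C.W α γ = 0 := by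
  simp only [← C.sum_c_diag, mul_sum]
  rw [sum_comm]
  simp [C.T_c_snd]

lemma T_W_snd (κ α : ι) : ∑ γ, C.T κ γ * C.W α γ = C.W α κ := by
  simp only [← C.sum_c_diag, mul_sum]
  rw [sum_comm]
  simp [C.T_c_fst]

lemma div_a (α γ : ι) : ∑ δ, C.D δ (C.a α δ γ) =
    C.W α γ - ∑ δ, ∑ ε, C.a ε δ α * C.a ε δ γ + ∑ δ, ∑ ε, C.a γ δ ε * C.a α δ ε := by
  have h : ∑ δ, C.c δ α δ γ = C.W α γ := by
    rw [← C.sum_c_diag]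
    exact sum_congr rfl fun δ _ => by rw [C.c_symm, C.codazzi]
  have h0 : ∑ δ, ∑ ε, C.a δ δ ε * C.a α ε γ = 0 := by
    rw [sum_comm]
    simp [← sum_mul, C.a_fst_fst]
  simp only [c, sum_sub_distrib, sum_add_distrib] at h
  linear_combination h + h0

lemma div_a_fst (β ε : ι) : ∑ δ, C.D δ (C.a δ β ε) = - ∑ κ, C.H κ * C.a κ β ε := by
  calc ∑ δ, C.D δ (C.a δ β ε) = ∑ δ, ∑ κ, C.T δ κ * C.D κ (C.a δ β ε) :=
        sum_congr rfl fun δ _ => (C.T_D δ _).symm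
    _ = ∑ κ, ∑ δ, C.T κ δ * C.D κ (C.a δ β ε) := by
        rw [sum_comm]
        exact sum_congr rfl fun κ _ => sum_congr rfl fun δ _ => by rw [C.T_symm]
    _ = - ∑ κ, C.H κ * C.a κ β ε := by
        simp only [C.T_Da_fst, sum_neg_distrib, H, sum_mul]
        rw [sum_comm]

/-- Squared norm of the second fundamental form. -/
def S : R := ∑ α, ∑ β, ∑ γ, C.a α β γ * C.a α β γ

lemma normal_mul_Da_trd {x : ι → R} (hx : ∀ κ, ∑ α, C.T κ α * x α = 0) (δ α β : ι) :
    ∑ γ, x γ * C.D δ (C.a α β γ) = ∑ γ, ∑ ε, x γ * C.a γ δ ε * C.a α β ε := by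
  simp only [C.a_symm α β]
  exact C.normal_mul_Da_snd hx δ α β

lemma a_mul_D (δ : ι) : ∑ α, ∑ β, ∑ γ, C.a α β γ * C.D δ (C.a α β γ) =
    ∑ α, ∑ β, ∑ γ, C.a α β γ * C.c δ α β γ := by
  have h : ∀ α β γ, C.D δ (C.a α β γ) = C.c δ α β γ - ∑ ε, C.a ε δ α * C.a ε β γ
      + ∑ ε, C.a β δ ε * C.a α ε γ + ∑ ε, C.a γ δ ε * C.a α β ε := fun α β γ => by
    simp only [c]; ring
  have h1 : ∑ α, ∑ β, ∑ γ, C.a α β γ * ∑ ε, C.a ε δ α * C.a ε β γ = 0 := by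
    rw [sum_comm]
    refine sum_eq_zero fun β _ => ?_
    rw [sum_comm]
    refine sum_eq_zero fun γ _ => ?_
    simp only [mul_sum]
    rw [sum_comm]
    refine sum_eq_zero fun ε _ => ?_
    calc _ = (∑ α, C.a ε δ α * C.a α β γ) * C.a ε β γ := by
          rw [sum_mul]; exact sum_congr rfl fun _ _ => by ring
      _ = 0 := by rw [C.a_trd_a_fst, zero_mul]
  have h2 : ∑ α, ∑ β, ∑ γ, C.a α β γ * ∑ ε, C.a β δ ε * C.a α ε γ = 0 := by
    refine sum_eq_zero fun α _ => ?_
    rw [sum_comm]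
    refine sum_eq_zero fun γ _ => ?_
    simp only [mul_sum]
    rw [sum_comm]
    refine sum_eq_zero fun ε _ => ?_
    simp only [← mul_assoc, ← sum_mul, C.a_snd_a_fst, zero_mul]
  have h3 : ∑ α, ∑ β, ∑ γ, C.a α β γ * ∑ ε, C.a γ δ ε * C.a α β ε = 0 := by
    refine sum_eq_zero fun α _ => sum_eq_zero fun β _ => ?_
    simp only [mul_sum]
    rw [sum_comm]
    refine sum_eq_zero fun ε _ => ?_
    simp only [← mul_assoc, ← sum_mul, C.a_trd_a_fst, zero_mul]
  simp only [h, mul_add, mul_sub, sum_add_distrib, sum_sub_distrib, h1, h2, h3]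
  ring

lemma D_mul_c (δ : ι) : ∑ α, ∑ β, ∑ γ, C.D δ (C.a α β γ) * C.c δ α β γ =
    ∑ α, ∑ β, ∑ γ, C.c δ α β γ * C.c δ α β γ := by
  have h : ∀ α β γ, C.D δ (C.a α β γ) = C.c δ α β γ - ∑ ε, C.a ε δ α * C.a ε β γ
      + ∑ ε, C.a β δ ε * C.a α ε γ + ∑ ε, C.a γ δ ε * C.a α β ε := fun α β γ => by
    simp only [c]; ring
  have k1 : ∀ ε β γ, ∑ α, C.a ε δ α * C.c δ α β γ = 0 := fun ε β γ =>
    C.sum_mul_eq_zero (fun κ => C.T_a_trd ε δ κ) (fun κ => C.T_c_snd κ δ β γ)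
  have k2 : ∀ ε α γ, ∑ β, C.c δ α β γ * C.a β δ ε = 0 := fun ε α γ =>
    C.sum_mul_eq_zero (fun κ => C.T_c_trd κ δ α γ) (fun κ => C.T_a_fst κ δ ε)
  have h1 : ∑ α, ∑ β, ∑ γ, (∑ ε, C.a ε δ α * C.a ε β γ) * C.c δ α β γ = 0 := by
    rw [sum_comm]
    refine sum_eq_zero fun β _ => ?_
    rw [sum_comm]
    refine sum_eq_zero fun γ _ => ?_
    simp only [sum_mul]
    rw [sum_comm]
    refine sum_eq_zero fun ε _ => ?_
    calc _ = (∑ α, C.a ε δ α * C.c δ α β γ) * C.a ε β γ := by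
          rw [sum_mul]; exact sum_congr rfl fun _ _ => by ring
      _ = 0 := by rw [k1, zero_mul]
  have h2 : ∑ α, ∑ β, ∑ γ, (∑ ε, C.a β δ ε * C.a α ε γ) * C.c δ α β γ = 0 := by
    refine sum_eq_zero fun α _ => ?_
    rw [sum_comm]
    refine sum_eq_zero fun γ _ => ?_
    simp only [sum_mul]
    rw [sum_comm]
    refine sum_eq_zero fun ε _ => ?_
    calc _ = (∑ β, C.c δ α β γ * C.a β δ ε) * C.a α ε γ := by
          rw [sum_mul]; exact sum_congr rfl fun _ _ => by ring
      _ = 0 := by rw [k2, zero_mul]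
  have h3 : ∑ α, ∑ β, ∑ γ, (∑ ε, C.a γ δ ε * C.a α β ε) * C.c δ α β γ = 0 := by
    rw [← h2]
    refine sum_congr rfl fun α _ => ?_
    rw [sum_comm]
    exact sum_congr rfl fun γ _ => sum_congr rfl fun β _ => by
      simp only [C.c_symm δ α β γ, C.a_symm α β]
  simp only [h, add_mul, sub_mul, sum_add_distrib, sum_sub_distrib, h1, h2, h3]
  ring

lemma sum_last_first (f : ι → ι → ι → ι → R) :
    ∑ α, ∑ β, ∑ γ, ∑ δ, f α β γ δ = ∑ δ, ∑ α, ∑ β, ∑ γ, f α β γ δ := by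
  calc _ = ∑ α, ∑ β, ∑ δ, ∑ γ, f α β γ δ :=
        sum_congr rfl fun _ _ => sum_congr rfl fun _ _ => sum_comm
    _ = ∑ α, ∑ δ, ∑ β, ∑ γ, f α β γ δ := sum_congr rfl fun _ _ => sum_comm
    _ = _ := sum_comm

/-- Laplacian of `|A|²`, before the third-order term is commuted. -/
lemma laplacian_S : ∑ δ, C.D δ (C.D δ C.S) =
    2 * ∑ δ, ∑ α, ∑ β, ∑ γ, C.c δ α β γ * C.c δ α β γ
      + 2 * ∑ α, ∑ β, ∑ γ, C.a α β γ * ∑ δ, C.D δ (C.c δ α β γ) := by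
  have h : ∀ δ, C.D δ C.S = ∑ α, ∑ β, ∑ γ, (C.a α β γ * C.c δ α β γ + C.a α β γ * C.c δ α β γ) := by
    intro δ
    simp only [sum_add_distrib]
    rw [← C.a_mul_D δ]
    simp only [S, map_sum, Derivation.leibniz, smul_eq_mul, sum_add_distrib]
  have h2 : ∑ α, ∑ β, ∑ γ, C.a α β γ * ∑ δ, C.D δ (C.c δ α β γ) =
      ∑ δ, ∑ α, ∑ β, ∑ γ, C.a α β γ * C.D δ (C.c δ α β γ) := by
    simp only [mul_sum]
    exact sum_last_first _
  rw [h2, mul_sum, mul_sum, ← sum_add_distrib]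
  refine sum_congr rfl fun δ _ => ?_
  rw [h, ← C.D_mul_c]
  simp only [map_sum, map_add, Derivation.leibniz, smul_eq_mul, sum_add_distrib, mul_comm (C.c _ _ _ _)]
  ring
/-- The square `∑ M^ε M^ε` of the shape operators. -/
def b (γ κ : ι) : R := ∑ δ, ∑ ε, C.a ε δ γ * C.a ε δ κ

/-- Mean curvature contracted against a cubic expression in the second fundamental form. -/
def HQ : R := ∑ β, ∑ ε, C.b β ε * ∑ κ, C.H κ * C.a κ β ε

/-- Flatness of the normal bundle: the shape operators commute. -/
def Flat : Prop := ∀ α ε γ κ, ∑ β, C.a α β γ * C.a ε β κ = ∑ β, C.a ε β γ * C.a α β κ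

lemma b_eq (γ κ : ι) : C.b γ κ = ∑ ε, ∑ δ, C.a ε γ δ * C.a ε κ δ := by
  rw [b, sum_comm]
  simp only [C.a_symm _ γ, C.a_symm _ κ]

lemma quartic_one : ∑ β, ∑ γ, ∑ α, C.a α β γ * C.D β (∑ δ, ∑ ε, C.a ε δ α * C.a ε δ γ) =
    ∑ γ, ∑ κ, C.b γ κ * C.b γ κ := by
  have h : ∀ β γ, ∑ α, C.a α β γ * C.D β (∑ δ, ∑ ε, C.a ε δ α * C.a ε δ γ) =
      ∑ κ, (∑ α, C.a α β γ * C.a α β κ) * C.b γ κ := by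
    intro β γ
    simp only [map_sum, Derivation.leibniz, smul_eq_mul, b]
    calc _ = ∑ δ, ∑ ε, ((∑ α, C.a ε δ α * C.a α β γ) * C.D β (C.a ε δ γ)
            + C.a ε δ γ * ∑ α, C.a α β γ * C.D β (C.a ε δ α)) := by
          simp only [mul_sum, sum_mul]
          rw [sum_comm]
          refine sum_congr rfl fun δ _ => ?_
          rw [sum_comm]
          refine sum_congr rfl fun ε _ => ?_
          rw [← sum_add_distrib]
          exact sum_congr rfl fun α _ => by ring
      _ = ∑ δ, ∑ ε, ∑ κ, ∑ α, C.a α β γ * C.a α β κ * (C.a ε δ γ * C.a ε δ κ) := by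
          refine sum_congr rfl fun δ _ => sum_congr rfl fun ε _ => ?_
          rw [C.a_trd_a_fst, C.normal_mul_Da_trd (fun κ => C.T_a_fst κ β γ), zero_mul, zero_add,
            sum_comm, mul_sum]
          refine sum_congr rfl fun κ _ => ?_
          rw [mul_sum]
          exact sum_congr rfl fun α _ => by ring
      _ = _ := by
          simp only [← sum_mul]
          calc _ = ∑ δ, ∑ κ, ∑ ε, (∑ α, C.a α β γ * C.a α β κ) * (C.a ε δ γ * C.a ε δ κ) :=
                sum_congr rfl fun _ _ => sum_comm
            _ = _ := by
                rw [sum_comm]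
                exact sum_congr rfl fun κ _ => by simp only [mul_sum]
  simp only [h]
  rw [sum_comm]
  refine sum_congr rfl fun γ _ => ?_
  rw [sum_comm]
  refine sum_congr rfl fun κ _ => ?_
  rw [← sum_mul, b]

lemma quartic_norm : ∑ α, ∑ β, ∑ γ, C.a α β γ * C.D β (∑ δ, ∑ ε, C.a γ δ ε * C.a α δ ε) =
    - ∑ α, ∑ μ, (∑ β, ∑ γ, C.a α β γ * C.a μ β γ) ^ 2 := by
  rw [← sum_neg_distrib]
  refine sum_congr rfl fun α _ => ?_
  have h : ∀ β, ∑ γ, C.a α β γ * C.D β (∑ δ, ∑ ε, C.a γ δ ε * C.a α δ ε) =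
      - ∑ μ, (∑ γ, C.a α β γ * C.a μ β γ) * ∑ δ, ∑ ε, C.a α δ ε * C.a μ δ ε := by
    intro β
    simp only [map_sum, Derivation.leibniz, smul_eq_mul]
    calc _ = ∑ δ, ∑ ε, ((∑ γ, C.a α β γ * C.a γ δ ε) * C.D β (C.a α δ ε)
            + C.a α δ ε * ∑ γ, C.a α β γ * C.D β (C.a γ δ ε)) := by
          simp only [mul_sum, sum_mul]
          rw [sum_comm]
          refine sum_congr rfl fun δ _ => ?_
          rw [sum_comm]
          refine sum_congr rfl fun ε _ => ?_
          rw [← sum_add_distrib]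
          exact sum_congr rfl fun α _ => by ring
      _ = - ∑ δ, ∑ ε, ∑ μ, (∑ γ, C.a α β γ * C.a μ β γ) * (C.a α δ ε * C.a μ δ ε) := by
          simp only [← sum_neg_distrib]
          refine sum_congr rfl fun δ _ => sum_congr rfl fun ε _ => ?_
          rw [C.a_trd_a_fst, C.tangential_mul_Da_fst (fun κ => C.T_a_trd α β κ), zero_mul, zero_add,
            sum_comm, mul_neg, mul_sum, ← sum_neg_distrib]
          refine sum_congr rfl fun μ _ => ?_
          rw [mul_sum, sum_mul, ← sum_neg_distrib, ← sum_neg_distrib]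
          exact sum_congr rfl fun α _ => by ring
      _ = _ := by
          congr 1
          calc _ = ∑ δ, ∑ μ, ∑ ε, (∑ γ, C.a α β γ * C.a μ β γ) * (C.a α δ ε * C.a μ δ ε) :=
                sum_congr rfl fun _ _ => sum_comm
            _ = _ := by
                rw [sum_comm]
                exact sum_congr rfl fun κ _ => by simp only [mul_sum]
  simp only [h, sum_neg_distrib]
  rw [sum_comm]
  congr 1
  refine sum_congr rfl fun μ _ => ?_
  rw [← sum_mul, sq]

lemma quartic_commutator : ∑ α, ∑ β, ∑ γ, C.a α β γ *
      ∑ δ, ∑ ε, C.a δ β ε * C.D ε (C.a α δ γ) = ∑ γ, ∑ κ, C.b γ κ * C.b γ κ := by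
  have h : ∀ α β γ, ∑ δ, ∑ ε, C.a δ β ε * C.D ε (C.a α δ γ) =
      ∑ μ, C.b β μ * C.a α μ γ := by
    intro α β γ
    rw [sum_comm]
    simp only [C.normal_mul_Da_snd (fun κ => C.T_a_fst κ β _)]
    calc _ = ∑ ε, ∑ μ, ∑ δ, C.a δ β ε * C.a δ ε μ * C.a α μ γ :=
          sum_congr rfl fun ε _ => sum_comm
      _ = _ := by
          rw [sum_comm]
          refine sum_congr rfl fun μ _ => ?_
          rw [b, sum_mul]
          refine sum_congr rfl fun ε _ => ?_
          rw [sum_mul]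
          exact sum_congr rfl fun δ _ => by rw [C.a_symm δ β ε]
  simp only [h]
  rw [sum_comm]
  refine sum_congr rfl fun β _ => ?_
  calc _ = ∑ α, ∑ μ, ∑ γ, C.b β μ * (C.a α β γ * C.a α μ γ) := by
        refine sum_congr rfl fun α _ => ?_
        rw [sum_comm]
        refine sum_congr rfl fun γ _ => ?_
        rw [mul_sum]
        exact sum_congr rfl fun μ _ => by ring
    _ = _ := by
        rw [sum_comm]
        refine sum_congr rfl fun μ _ => ?_
        simp only [← mul_sum]
        rw [← C.b_eq]

lemma quartic_alternating (hC : C.Flat) : ∑ β, ∑ γ, ∑ α, C.a α β γ *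
      ∑ δ, C.D δ (∑ ε, C.a ε β α * C.a ε δ γ) = ∑ γ, ∑ κ, C.b γ κ * C.b γ κ := by
  have h : ∀ β γ, ∑ α, C.a α β γ * ∑ δ, C.D δ (∑ ε, C.a ε β α * C.a ε δ γ) =
      ∑ δ, ∑ ε, ∑ κ, ∑ α, C.a α β γ * C.a ε β κ * (C.a ε δ γ * C.a α δ κ) := by
    intro β γ
    simp only [map_sum, Derivation.leibniz, smul_eq_mul]
    calc _ = ∑ δ, ∑ ε, ((∑ α, C.a ε β α * C.a α β γ) * C.D δ (C.a ε δ γ)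
            + C.a ε δ γ * ∑ α, C.a α β γ * C.D δ (C.a ε β α)) := by
          simp only [mul_sum, sum_mul]
          rw [sum_comm]
          refine sum_congr rfl fun δ _ => ?_
          rw [sum_comm]
          refine sum_congr rfl fun ε _ => ?_
          rw [← sum_add_distrib]
          exact sum_congr rfl fun α _ => by ring
      _ = _ := by
          refine sum_congr rfl fun δ _ => sum_congr rfl fun ε _ => ?_
          rw [C.a_trd_a_fst, C.normal_mul_Da_trd (fun κ => C.T_a_fst κ β γ), zero_mul, zero_add,
            sum_comm, mul_sum]
          refine sum_congr rfl fun κ _ => ?_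
          rw [mul_sum]
          exact sum_congr rfl fun α _ => by ring
  simp only [h]
  calc _ = ∑ γ, ∑ δ, ∑ ε, ∑ κ, ∑ α,
        (∑ β, C.a α β γ * C.a ε β κ) * (C.a ε δ γ * C.a α δ κ) := by
        rw [sum_comm]
        refine sum_congr rfl fun γ _ => ?_
        rw [sum_comm]
        refine sum_congr rfl fun δ _ => ?_
        rw [sum_comm]
        refine sum_congr rfl fun ε _ => ?_
        rw [sum_comm]
        refine sum_congr rfl fun κ _ => ?_
        rw [sum_comm]
        refine sum_congr rfl fun α _ => ?_
        rw [sum_mul]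
    _ = ∑ γ, ∑ δ, ∑ ε, ∑ β, C.a ε β γ * C.a ε δ γ * C.b β δ := by
        refine sum_congr rfl fun γ _ => sum_congr rfl fun δ _ => sum_congr rfl fun ε _ => ?_
        simp only [hC _ ε, C.b_eq, sum_mul, mul_sum]
        calc _ = ∑ κ, ∑ β, ∑ α, C.a ε β γ * C.a α β κ * (C.a ε δ γ * C.a α δ κ) :=
              sum_congr rfl fun _ _ => sum_comm
          _ = _ := by
              rw [sum_comm]
              refine sum_congr rfl fun β _ => ?_
              rw [sum_comm]
              exact sum_congr rfl fun α _ => sum_congr rfl fun κ _ => by ring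
    _ = _ := by
        calc _ = ∑ γ, ∑ δ, ∑ β, ∑ ε, C.a ε β γ * C.a ε δ γ * C.b β δ :=
              sum_congr rfl fun _ _ => sum_congr rfl fun _ _ => sum_comm
          _ = ∑ δ, ∑ β, ∑ γ, ∑ ε, C.a ε β γ * C.a ε δ γ * C.b β δ := by
              rw [sum_comm]
              exact sum_congr rfl fun _ _ => sum_comm
          _ = _ := by
              rw [sum_comm]
              refine sum_congr rfl fun β _ => sum_congr rfl fun δ _ => ?_
              simp only [← sum_mul]
              rw [sum_comm, ← C.b_eq]

lemma quartic_mean : ∑ α, ∑ β, ∑ γ, C.a α β γ *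
      ∑ δ, C.D δ (∑ ε, C.a δ β ε * C.a α ε γ) = - C.HQ := by
  have h : ∀ α β γ, ∑ δ, C.D δ (∑ ε, C.a δ β ε * C.a α ε γ) =
      - ∑ ε, C.a α ε γ * ∑ κ, C.H κ * C.a κ β ε := by
    intro α β γ
    simp only [map_sum, Derivation.leibniz, smul_eq_mul]
    rw [sum_comm, ← sum_neg_distrib]
    refine sum_congr rfl fun ε _ => ?_
    rw [sum_add_distrib, C.a_fst_D, ← mul_sum, C.div_a_fst]
    ring
  simp only [h, mul_neg, sum_neg_distrib]
  congr 1
  rw [sum_comm, HQ]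
  refine sum_congr rfl fun β _ => ?_
  calc _ = ∑ α, ∑ ε, ∑ γ, C.a α β γ * C.a α ε γ * ∑ κ, C.H κ * C.a κ β ε := by
        refine sum_congr rfl fun α _ => ?_
        rw [sum_comm]
        refine sum_congr rfl fun γ _ => ?_
        rw [mul_sum]
        exact sum_congr rfl fun ε _ => by ring
    _ = _ := by
        rw [sum_comm]
        refine sum_congr rfl fun ε _ => ?_
        simp only [← sum_mul]
        rw [← C.b_eq]

lemma quartic_alternating' (hC : C.Flat) : ∑ α, ∑ β, ∑ γ, C.a α β γ *
      ∑ δ, C.D δ (∑ ε, C.a γ β ε * C.a α δ ε) = - ∑ γ, ∑ κ, C.b γ κ * C.b γ κ := by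
  have h : ∀ α β, ∑ γ, C.a α β γ * ∑ δ, C.D δ (∑ ε, C.a γ β ε * C.a α δ ε) =
      - ∑ δ, ∑ ε, ∑ κ, ∑ μ, C.a α β κ * C.a μ β ε * (C.a μ δ κ * C.a α δ ε) := by
    intro α β
    simp only [map_sum, Derivation.leibniz, smul_eq_mul]
    calc _ = ∑ δ, ∑ ε, ((∑ γ, C.a α β γ * C.a γ β ε) * C.D δ (C.a α δ ε)
            + C.a α δ ε * ∑ γ, C.a α β γ * C.D δ (C.a γ β ε)) := by
          simp only [mul_sum, sum_mul]
          rw [sum_comm]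
          refine sum_congr rfl fun δ _ => ?_
          rw [sum_comm]
          refine sum_congr rfl fun ε _ => ?_
          rw [← sum_add_distrib]
          exact sum_congr rfl fun α _ => by ring
      _ = _ := by
          simp only [← sum_neg_distrib]
          refine sum_congr rfl fun δ _ => sum_congr rfl fun ε _ => ?_
          rw [C.a_trd_a_fst, C.tangential_mul_Da_fst (fun κ => C.T_a_trd α β κ), zero_mul, zero_add,
            mul_neg, mul_sum, ← sum_neg_distrib]
          refine sum_congr rfl fun κ _ => ?_
          rw [mul_sum, ← sum_neg_distrib]
          exact sum_congr rfl fun μ _ => by ring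
  simp only [h, sum_neg_distrib]
  congr 1
  calc _ = ∑ α, ∑ δ, ∑ ε, ∑ κ, ∑ μ,
        (∑ β, C.a α β κ * C.a μ β ε) * (C.a μ δ κ * C.a α δ ε) := by
        refine sum_congr rfl fun α _ => ?_
        rw [sum_comm]
        refine sum_congr rfl fun δ _ => ?_
        rw [sum_comm]
        refine sum_congr rfl fun ε _ => ?_
        rw [sum_comm]
        refine sum_congr rfl fun κ _ => ?_
        rw [sum_comm]
        refine sum_congr rfl fun μ _ => ?_
        rw [sum_mul]
    _ = ∑ α, ∑ δ, ∑ ε, ∑ β, C.a α β ε * C.a α δ ε * C.b β δ := by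
        refine sum_congr rfl fun α _ => sum_congr rfl fun δ _ => sum_congr rfl fun ε _ => ?_
        simp only [hC α, C.b_eq, sum_mul, mul_sum]
        calc _ = ∑ κ, ∑ β, ∑ μ, C.a μ β κ * C.a α β ε * (C.a μ δ κ * C.a α δ ε) :=
              sum_congr rfl fun _ _ => sum_comm
          _ = _ := by
              rw [sum_comm]
              refine sum_congr rfl fun β _ => ?_
              rw [sum_comm]
              exact sum_congr rfl fun α _ => sum_congr rfl fun κ _ => by ring
    _ = _ := by
        calc _ = ∑ α, ∑ δ, ∑ β, ∑ ε, C.a α β ε * C.a α δ ε * C.b β δ :=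
              sum_congr rfl fun _ _ => sum_congr rfl fun _ _ => sum_comm
          _ = ∑ δ, ∑ β, ∑ α, ∑ ε, C.a α β ε * C.a α δ ε * C.b β δ := by
              rw [sum_comm]
              exact sum_congr rfl fun _ _ => sum_comm
          _ = _ := by
              rw [sum_comm]
              refine sum_congr rfl fun β _ => sum_congr rfl fun δ _ => ?_
              simp only [← sum_mul]
              rw [← C.b_eq]

/-- Simons' identity, for a flat normal bundle. -/
lemma simons (hC : C.Flat) : ∑ α, ∑ β, ∑ γ, C.a α β γ * ∑ δ, C.D δ (C.c δ α β γ) =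
    ∑ α, ∑ β, ∑ γ, C.a α β γ * C.D β (C.W α γ) + C.HQ
      - ∑ α, ∑ μ, (∑ β, ∑ γ, C.a α β γ * C.a μ β γ) ^ 2 := by
  have h : ∀ α β γ, C.a α β γ * ∑ δ, C.D δ (C.c δ α β γ) =
      C.a α β γ * C.D β (C.W α γ)
      - C.a α β γ * C.D β (∑ δ, ∑ ε, C.a ε δ α * C.a ε δ γ)
      + C.a α β γ * C.D β (∑ δ, ∑ ε, C.a γ δ ε * C.a α δ ε)
      + C.a α β γ * ∑ δ, ∑ ε, C.a β δ ε * C.D ε (C.a α δ γ)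
      - C.a α β γ * ∑ δ, ∑ ε, C.a δ β ε * C.D ε (C.a α δ γ)
      + C.a α β γ * ∑ δ, C.D δ (∑ ε, C.a ε β α * C.a ε δ γ)
      - C.a α β γ * ∑ δ, C.D δ (∑ ε, C.a δ β ε * C.a α ε γ)
      - C.a α β γ * ∑ δ, C.D δ (∑ ε, C.a γ β ε * C.a α δ ε) := by
    intro α β γ
    have h1 : ∑ δ, C.D δ (C.D β (C.a α δ γ)) =
        C.D β (∑ δ, C.D δ (C.a α δ γ)) + ∑ δ, ∑ ε, C.a β δ ε * C.D ε (C.a α δ γ)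
          - ∑ δ, ∑ ε, C.a δ β ε * C.D ε (C.a α δ γ) := by
      rw [map_sum, ← sum_add_distrib, ← sum_sub_distrib]
      refine sum_congr rfl fun δ _ => ?_
      have h2 := C.D_comm δ β (C.a α δ γ)
      simp only [sub_mul, sum_sub_distrib] at h2
      linear_combination h2
    have h3 : ∑ δ, C.D δ (C.c δ α β γ) = ∑ δ, C.D δ (C.c β α δ γ) :=
      sum_congr rfl fun δ _ => by rw [C.codazzi]
    rw [h3]
    simp only [c, map_add, map_sub, sum_add_distrib, sum_sub_distrib]
    rw [h1, C.div_a, map_add, map_sub]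
    ring
  have h0 : ∑ α, ∑ β, ∑ γ, C.a α β γ * ∑ δ, ∑ ε, C.a β δ ε * C.D ε (C.a α δ γ) = 0 := by
    refine sum_eq_zero fun α _ => ?_
    rw [sum_comm]
    refine sum_eq_zero fun γ _ => ?_
    simp only [mul_sum]
    rw [sum_comm]
    refine sum_eq_zero fun δ _ => ?_
    rw [sum_comm]
    refine sum_eq_zero fun ε _ => ?_
    simp only [← mul_assoc, ← sum_mul, C.a_snd_a_fst, zero_mul]
  have r : ∀ f : ι → ι → ι → R, ∑ α, ∑ β, ∑ γ, f α β γ = ∑ β, ∑ γ, ∑ α, f α β γ := fun f => by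
    rw [sum_comm]
    exact sum_congr rfl fun _ _ => sum_comm
  have q1 := C.quartic_one
  have q2 := C.quartic_alternating hC
  rw [← r] at q1 q2
  simp only [h, sum_add_distrib, sum_sub_distrib]
  rw [h0, q1, q2, C.quartic_norm, C.quartic_commutator, C.quartic_mean, C.quartic_alternating' hC]
  ring

/-- The evolution of the second fundamental form contracted against itself, when the normal
velocity is `H`. -/
lemma evolution : ∑ α, ∑ β, ∑ γ, C.a α β γ *
      (∑ κ, (C.W β κ - C.D β (C.H κ)) * C.D κ (C.T α γ) + C.D β (C.W α γ + C.W γ α)) =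
    ∑ α, ∑ β, ∑ γ, C.a α β γ * C.D β (C.W α γ) + C.HQ := by
  have aW : ∀ α γ κ, ∑ β, C.a α β γ * C.W β κ = 0 := fun α γ κ =>
    C.sum_mul_eq_zero (fun μ => C.T_a_snd α μ γ) (fun μ => C.T_W_fst μ κ)
  have aW' : ∀ α β κ, ∑ γ, C.a α β γ * C.W γ κ = 0 := fun α β κ =>
    C.sum_mul_eq_zero (fun μ => C.T_a_trd α β μ) (fun μ => C.T_W_fst μ κ)
  have h1 : ∑ α, ∑ β, ∑ γ, C.a α β γ * ∑ κ, C.W β κ * C.D κ (C.T α γ) = 0 := by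
    refine sum_eq_zero fun α _ => ?_
    rw [sum_comm]
    refine sum_eq_zero fun γ _ => ?_
    simp only [mul_sum]
    rw [sum_comm]
    refine sum_eq_zero fun κ _ => ?_
    simp only [← mul_assoc, ← sum_mul, aW, zero_mul]
  have h2 : ∑ α, ∑ β, ∑ γ, C.a α β γ * C.D β (C.W γ α) = 0 := by
    have e : ∀ α β, ∑ γ, C.a α β γ * C.D β (C.W γ α) =
        ∑ κ, C.T α κ * ∑ γ, C.a α β γ * C.D β (C.W γ κ) := by
      intro α β
      have : ∀ γ, C.D β (C.W γ α) = ∑ κ, (C.T α κ * C.D β (C.W γ κ)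
          + C.W γ κ * (C.a α β κ + C.a κ β α)) := fun γ => by
        simp only [← C.D_T]
        conv_lhs => rw [← C.T_W_snd α γ]
        simp only [map_sum, Derivation.leibniz, smul_eq_mul]
      simp only [this, mul_sum]
      rw [sum_comm]
      refine sum_congr rfl fun κ _ => ?_
      have z : ∑ γ, C.a α β γ * (C.W γ κ * (C.a α β κ + C.a κ β α)) = 0 := by
        simp only [← mul_assoc, ← sum_mul, aW', zero_mul]
      simp only [mul_add] at z ⊢
      rw [sum_add_distrib, z, add_zero]
      exact sum_congr rfl fun γ _ => by ring
    simp only [e]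
    rw [sum_comm]
    refine sum_eq_zero fun β _ => ?_
    simp only [mul_sum]
    rw [sum_comm]
    refine sum_eq_zero fun κ _ => ?_
    rw [sum_comm]
    refine sum_eq_zero fun γ _ => ?_
    calc _ = (∑ α, C.T κ α * C.a α β γ) * C.D β (C.W γ κ) := by
          rw [sum_mul]; exact sum_congr rfl fun α _ => by rw [C.T_symm α κ]; ring
      _ = 0 := by rw [C.T_a_fst, zero_mul]
  have h3 : ∑ α, ∑ β, ∑ γ, C.a α β γ * ∑ κ, C.D β (C.H κ) * C.D κ (C.T α γ) = - C.HQ := by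
    have e : ∀ α β γ, ∑ κ, C.D β (C.H κ) * C.D κ (C.T α γ) =
        ∑ κ, C.a γ κ α * C.D β (C.H κ)
          - ∑ κ, C.a α κ γ * ∑ ε, C.H ε * C.a ε β κ := by
      intro α β γ
      have e1 : ∑ κ, C.a α γ κ * C.D β (C.H κ) =
          - ∑ κ, C.a α κ γ * ∑ ε, C.H ε * C.a ε β κ := by
        simp only [H, map_sum, mul_sum, sum_mul]
        rw [sum_comm]
        simp only [C.tangential_mul_Da_fst (fun μ => C.T_a_trd α γ μ), sum_neg_distrib]
        congr 1
        rw [sum_comm]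
        refine sum_congr rfl fun κ _ => ?_
        rw [sum_comm]
        refine sum_congr rfl fun ε _ => sum_congr rfl fun μ _ => ?_
        rw [C.a_symm α γ κ]
        ring
      simp only [C.D_T, mul_add, sum_add_distrib]
      rw [sub_eq_add_neg, ← e1, add_comm]
      congr 1
      · exact sum_congr rfl fun κ _ => mul_comm _ _
      · exact sum_congr rfl fun κ _ => by rw [C.a_symm α γ κ]; ring
    have z : ∀ α β, ∑ γ, C.a α β γ * ∑ κ, C.a γ κ α * C.D β (C.H κ) = 0 := by
      intro α β
      simp only [mul_sum]
      rw [sum_comm]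
      refine sum_eq_zero fun κ _ => ?_
      simp only [← mul_assoc, ← sum_mul, C.a_trd_a_fst, zero_mul]
    simp only [e, mul_sub, sum_sub_distrib, z, zero_sub, sum_neg_distrib]
    congr 1
    rw [sum_comm, HQ]
    refine sum_congr rfl fun β _ => ?_
    calc _ = ∑ α, ∑ κ, ∑ γ, C.a α β γ * C.a α κ γ * ∑ ε, C.H ε * C.a ε β κ := by
          refine sum_congr rfl fun α _ => ?_
          rw [sum_comm]
          refine sum_congr rfl fun γ _ => ?_
          rw [mul_sum]
          exact sum_congr rfl fun κ _ => by ring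
      _ = _ := by
          rw [sum_comm]
          refine sum_congr rfl fun κ _ => ?_
          simp only [← sum_mul]
          rw [← C.b_eq]
  have e : ∀ α β γ, C.a α β γ *
      (∑ κ, (C.W β κ - C.D β (C.H κ)) * C.D κ (C.T α γ) + C.D β (C.W α γ + C.W γ α)) =
      C.a α β γ * ∑ κ, C.W β κ * C.D κ (C.T α γ)
      - C.a α β γ * ∑ κ, C.D β (C.H κ) * C.D κ (C.T α γ)
      + C.a α β γ * C.D β (C.W α γ) + C.a α β γ * C.D β (C.W γ α) := fun α β γ => by
    simp only [sub_mul, sum_sub_distrib, map_add]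
    ring
  simp only [e, sum_add_distrib, sum_sub_distrib]
  rw [h1, h2, h3]
  ring

/-- Combination of the evolution equation and of Simons' identity. -/
lemma evolution_eq_laplacian (hC : C.Flat) : 2 * ∑ α, ∑ β, ∑ γ, C.a α β γ *
      (∑ κ, (C.W β κ - C.D β (C.H κ)) * C.D κ (C.T α γ) + C.D β (C.W α γ + C.W γ α)) =
    ∑ δ, C.D δ (C.D δ C.S) - 2 * ∑ δ, ∑ α, ∑ β, ∑ γ, C.c δ α β γ * C.c δ α β γ
      + 2 * ∑ α, ∑ μ, (∑ β, ∑ γ, C.a α β γ * C.a μ β γ) ^ 2 := by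
  rw [C.evolution, C.laplacian_S, C.simons hC]
  ring

end TangentialCalculus
end Core

section MatrixCalculus

open Matrix

variable {R ι ν : Type*} [CommRing R] [Fintype ι] [Fintype ν] [DecidableEq ι] [DecidableEq ν]

/-- First variation of the orthogonal projector `F * E`, where `E` is the pseudo-inverse of `F`. -/
lemma deriv_projector {F F' : Matrix ν ι R} {E E' : Matrix ι ν R} (hEF : E * F = 1)
    (hs : (F * E)ᵀ = F * E) (h' : E' * F + E * F' = 0)
    (hs' : (F' * E + F * E')ᵀ = F' * E + F * E') :
    F' * E + F * E' = (1 - F * E) * F' * E + ((1 - F * E) * F' * E)ᵀ := by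
  have h1 : (F' * E + F * E') * (F * E) = (1 - F * E) * F' * E := by
    have : E' * F = - (E * F') := eq_neg_of_add_eq_zero_left h'
    calc _ = F' * (E * F) * E + F * (E' * F) * E := by simp only [Matrix.add_mul, Matrix.mul_assoc]
      _ = _ := by
        rw [hEF, this]
        simp only [Matrix.sub_mul, Matrix.mul_one, Matrix.one_mul, Matrix.mul_neg, Matrix.neg_mul,
          Matrix.mul_assoc]
        rw [← sub_eq_add_neg]
  have h2 : (F * E) * (F' * E + F * E') = ((1 - F * E) * F' * E)ᵀ := by
    rw [← h1, Matrix.transpose_mul, hs, hs']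
  rw [← h2]
  have h3 : F * E * (F * E') = F * E' := by
    rw [Matrix.mul_assoc, ← Matrix.mul_assoc E, hEF, Matrix.one_mul]
  rw [Matrix.mul_add, h3]
  simp only [Matrix.sub_mul, Matrix.one_mul, Matrix.mul_assoc]
  abel

/-- First variation of the pseudo-inverse. -/
lemma deriv_pseudoinverse {F F' : Matrix ν ι R} {E E' : Matrix ι ν R} (hEF : E * F = 1)
    (hs : (F * E)ᵀ = F * E) (h' : E' * F + E * F' = 0)
    (hs' : (F' * E + F * E')ᵀ = F' * E + F * E') :
    E' = E * ((1 - F * E) * F' * E)ᵀ - E * F' * E := by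
  have h := congrArg (E * ·) (deriv_projector hEF hs h' hs')
  simp only [Matrix.mul_add] at h
  have h1 : E * (F * E') = E' := by rw [← Matrix.mul_assoc, hEF, Matrix.one_mul]
  have h2 : E * ((1 - F * E) * F' * E) = 0 := by
    rw [Matrix.mul_assoc, ← Matrix.mul_assoc E, Matrix.mul_sub, ← Matrix.mul_assoc E, hEF]
    simp
  rw [h1, h2, zero_add, ← Matrix.mul_assoc] at h
  rw [← h]
  abel

end MatrixCalculus

section Immersion

open Matrix

/-- The algebraic data of an immersion in coordinates: commuting coordinate derivations `d i`, the
differential `F` and its pseudo-inverse `E`. -/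
structure ImmersionCalculus (k R ι ν : Type*) [CommRing k] [CommRing R] [Algebra k R]
    [Fintype ι] [Fintype ν] [DecidableEq ι] [DecidableEq ν] where
  d : ι → Derivation k R R
  F : Matrix ν ι R
  E : Matrix ι ν R
  d_comm : ∀ i j f, d i (d j f) = d j (d i f)
  E_mul_F : E * F = 1
  F_mul_E_symm : (F * E)ᵀ = F * E
  d_F : ∀ i j α, d i (F α j) = d j (F α i)

namespace ImmersionCalculus

variable {k R ι ν : Type*} [CommRing k] [CommRing R] [Algebra k R]
    [Fintype ι] [Fintype ν] [DecidableEq ι] [DecidableEq ν] (I : ImmersionCalculus k R ι ν)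

/-- Tangential projector. -/
def T : Matrix ν ν R := I.F * I.E

/-- Coordinate derivative of the differential. -/
def dF (l : ι) : Matrix ν ι R := fun α j => I.d l (I.F α j)

/-- Christoffel symbols. -/
def Γ (p l j : ι) : R := (I.E * I.dF l) p j

/-- Second fundamental form in coordinates. -/
def A (l : ι) : Matrix ν ι R := (1 - I.F * I.E) * I.dF l

/-- Second fundamental form with ambient indices. -/
def a (α β γ : ν) : R := ∑ i, I.E i β * (I.A i * I.E) α γ

/-- Tangential derivative in an ambient direction. -/
def D (β : ν) : Derivation k R R := ∑ i, I.E i β • I.d i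

lemma D_apply (β : ν) (f : R) : I.D β f = ∑ i, I.E i β * I.d i f := by
  simp only [D, ← Derivation.coeFnAddMonoidHom_apply, map_sum, Finset.sum_apply]
  simp

lemma map_mul_derivation {μ κ lam : Type*} [Fintype κ] (δ : Derivation k R R) (M : Matrix μ κ R)
    (N : Matrix κ lam R) : (M * N).map δ = M.map δ * N + M * N.map δ := by
  ext i j
  simp only [Matrix.map_apply, Matrix.mul_apply, Matrix.add_apply, map_sum, Derivation.leibniz,
    smul_eq_mul, ← sum_add_distrib]
  exact sum_congr rfl fun _ _ => by ring

lemma variation_E_F (l : ι) : I.E.map (I.d l) * I.F + I.E * I.dF l = 0 := by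
  have h := congrArg (fun M => M.map (I.d l)) I.E_mul_F
  simp only [map_mul_derivation] at h
  rw [show I.dF l = I.F.map (I.d l) from rfl, h]
  ext i j
  by_cases hij : i = j <;> simp [hij]

lemma variation_symm (l : ι) : (I.dF l * I.E + I.F * I.E.map (I.d l))ᵀ =
    I.dF l * I.E + I.F * I.E.map (I.d l) := by
  rw [show I.dF l = I.F.map (I.d l) from rfl, ← map_mul_derivation, ← Matrix.transpose_map,
    I.F_mul_E_symm]

lemma T_map (l : ι) : I.T.map (I.d l) = I.A l * I.E + (I.A l * I.E)ᵀ := by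
  rw [T, map_mul_derivation, A, ← deriv_projector I.E_mul_F I.F_mul_E_symm (I.variation_E_F l)
    (I.variation_symm l)]
  rfl

lemma E_map (l : ι) : I.E.map (I.d l) = I.E * (I.A l * I.E)ᵀ - I.E * I.dF l * I.E :=
  deriv_pseudoinverse I.E_mul_F I.F_mul_E_symm (I.variation_E_F l) (I.variation_symm l)

lemma Γ_symm (p l j : ι) : I.Γ p l j = I.Γ p j l := by
  simp only [Γ, Matrix.mul_apply, dF, I.d_F l j]

lemma A_apply (α : ν) (l j : ι) : I.A l α j = I.d l (I.F α j) - ∑ p, I.Γ p l j * I.F α p := by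
  simp only [A, Matrix.sub_mul, Matrix.one_mul, Matrix.sub_apply, Matrix.mul_assoc]
  rw [Matrix.mul_apply]
  simp only [mul_comm (I.F α _)]
  rfl

lemma A_symm (α : ν) (l j : ι) : I.A l α j = I.A j α l := by
  simp only [A_apply, I.d_F l j, I.Γ_symm _ l j]

lemma a_eq (α β γ : ν) : I.a α β γ = ∑ i, ∑ j, I.E i β * I.E j γ * I.A i α j := by
  simp only [a, Matrix.mul_apply, mul_sum]
  exact sum_congr rfl fun _ _ => sum_congr rfl fun _ _ => by ring

lemma T_mul_F : I.T * I.F = I.F := by rw [T, Matrix.mul_assoc, I.E_mul_F, Matrix.mul_one]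

lemma E_mul_T : I.E * I.T = I.E := by rw [T, ← Matrix.mul_assoc, I.E_mul_F, Matrix.one_mul]

lemma T_mul_A (l : ι) : I.T * I.A l = 0 := by
  have : I.T * (1 - I.F * I.E) = 0 := by
    rw [Matrix.mul_sub, ← Matrix.mul_assoc, T_mul_F, Matrix.mul_one, T, sub_self]
  rw [A, ← Matrix.mul_assoc, this, Matrix.zero_mul]

lemma T_symm (α β : ν) : I.T α β = I.T β α := by
  conv_lhs => rw [T, ← I.F_mul_E_symm]
  rfl

lemma T_E (β : ν) (i : ι) : ∑ κ, I.T β κ * I.E i κ = I.E i β := by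
  conv_rhs => rw [← I.E_mul_T, Matrix.mul_apply]
  exact sum_congr rfl fun κ _ => by rw [I.T_symm β κ, mul_comm]

lemma D_T (γ α β : ν) : I.D γ (I.T α β) = I.a α γ β + I.a β γ α := by
  rw [D_apply, a, a, ← sum_add_distrib]
  refine sum_congr rfl fun i _ => ?_
  have := congrFun (congrFun (I.T_map i) α) β
  rw [Matrix.map_apply] at this
  rw [this, Matrix.add_apply, Matrix.transpose_apply, mul_add]

lemma D_E (β γ : ν) (i : ι) : I.D β (I.E i γ) =
    ∑ δ, I.E i δ * I.a γ β δ - ∑ l, ∑ j, I.E l β * I.E j γ * I.Γ i l j := by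
  have h : ∀ l, I.d l (I.E i γ) = ∑ δ, I.E i δ * (I.A l * I.E) γ δ - ∑ j, I.Γ i l j * I.E j γ := by
    intro l
    have := congrFun (congrFun (I.E_map l) i) γ
    rw [Matrix.map_apply] at this
    rw [this, Matrix.sub_apply, Matrix.mul_apply (M := I.E), Matrix.mul_apply (N := I.E)]
    rfl
  simp only [D_apply, h, mul_sub, sum_sub_distrib, a, mul_sum]
  congr 1
  · rw [sum_comm]
    exact sum_congr rfl fun _ _ => sum_congr rfl fun _ _ => by ring
  · exact sum_congr rfl fun _ _ => sum_congr rfl fun _ _ => by ring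

lemma D_D (β γ : ν) (f : R) : I.D β (I.D γ f) =
    ∑ δ, I.a γ β δ * I.D δ f
      + ∑ l, ∑ j, I.E l β * I.E j γ * (I.d l (I.d j f) - ∑ i, I.Γ i l j * I.d i f) := by
  have h : I.D β (I.D γ f) = ∑ i, I.D β (I.E i γ) * I.d i f
      + ∑ i, I.E i γ * I.D β (I.d i f) := by
    rw [I.D_apply γ f]
    simp only [map_sum, Derivation.leibniz, smul_eq_mul, sum_add_distrib]
    rw [add_comm]
    congr 1
    exact sum_congr rfl fun _ _ => mul_comm _ _
  rw [h]
  simp only [D_E]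
  simp only [D_apply, sub_mul, mul_sub, sum_sub_distrib, mul_sum, sum_mul]
  have e1 : ∑ i, ∑ δ, I.E i δ * I.a γ β δ * I.d i f = ∑ δ, ∑ i, I.a γ β δ * (I.E i δ * I.d i f) := by
    rw [sum_comm]
    exact sum_congr rfl fun _ _ => sum_congr rfl fun _ _ => by ring
  have e2 : ∑ i, ∑ l, I.E i γ * (I.E l β * I.d l (I.d i f)) =
      ∑ l, ∑ j, I.E l β * I.E j γ * I.d l (I.d j f) := by
    rw [sum_comm]
    exact sum_congr rfl fun _ _ => sum_congr rfl fun _ _ => by ring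
  have e3 : ∑ i, ∑ l, ∑ j, I.E l β * I.E j γ * I.Γ i l j * I.d i f =
      ∑ l, ∑ j, ∑ i, I.E l β * I.E j γ * (I.Γ i l j * I.d i f) := by
    rw [sum_comm]
    refine sum_congr rfl fun _ _ => ?_
    rw [sum_comm]
    exact sum_congr rfl fun _ _ => sum_congr rfl fun _ _ => by ring
  rw [e1, e2, e3]
  ring

/-- The tangential calculus of an immersion. -/
def tangential : TangentialCalculus k R ν where
  D := I.D
  T := I.T
  a := I.a
  T_symm := I.T_symm
  D_T := I.D_T
  a_symm α β γ := by
    rw [a_eq, a_eq, sum_comm]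
    exact sum_congr rfl fun i _ => sum_congr rfl fun j _ => by rw [I.A_symm]; ring
  T_a_fst α β γ := by
    simp only [a, mul_sum]
    rw [sum_comm]
    refine sum_eq_zero fun i _ => ?_
    have h : (I.T * (I.A i * I.E)) α γ = 0 := by
      rw [← Matrix.mul_assoc, T_mul_A, Matrix.zero_mul]; rfl
    rw [Matrix.mul_apply] at h
    calc _ = I.E i β * ∑ κ, I.T α κ * (I.A i * I.E) κ γ := by
          rw [mul_sum]; exact sum_congr rfl fun _ _ => by ring
      _ = 0 := by rw [h, mul_zero]
  T_a_snd α β γ := by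
    simp only [a, mul_sum]
    rw [sum_comm]
    refine sum_congr rfl fun i _ => ?_
    rw [← I.T_E β i, sum_mul]
    exact sum_congr rfl fun _ _ => by ring
  T_D β f := by
    simp only [D_apply, mul_sum]
    rw [sum_comm]
    refine sum_congr rfl fun i _ => ?_
    rw [← I.T_E β i, sum_mul]
    exact sum_congr rfl fun _ _ => by ring
  D_comm β γ f := by
    rw [D_D, D_D]
    have : ∑ l, ∑ j, I.E l β * I.E j γ * (I.d l (I.d j f) - ∑ i, I.Γ i l j * I.d i f) =
        ∑ l, ∑ j, I.E l γ * I.E j β * (I.d l (I.d j f) - ∑ i, I.Γ i l j * I.d i f) := by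
      rw [sum_comm]
      refine sum_congr rfl fun l _ => sum_congr rfl fun j _ => ?_
      simp only [I.d_comm l j, I.Γ_symm _ l j]
      ring
    rw [this]
    simp only [sub_mul, sum_sub_distrib]
    ring

/-- Inverse metric. -/
def gi : Matrix ι ι R := I.E * I.Eᵀ

lemma sum_E_E (i j : ι) : ∑ β, I.E i β * I.E j β = I.gi i j := by
  simp [gi, Matrix.mul_apply]

/-- The Laplace–Beltrami operator is the sum of the squared tangential derivatives. -/
lemma laplacian (f : R) : ∑ β, I.D β (I.D β f) =
    ∑ i, ∑ j, I.gi i j * (I.d j (I.d i f) - ∑ p, I.Γ p i j * I.d p f) := by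
  simp only [D_D, sum_add_distrib]
  have h : ∑ β, ∑ δ, I.a β β δ * I.D δ f = 0 := by
    rw [sum_comm]
    refine sum_eq_zero fun δ _ => ?_
    rw [← sum_mul, show ∑ β, I.a β β δ = 0 from I.tangential.a_fst_fst δ, zero_mul]
  rw [h, zero_add, sum_comm]
  refine sum_congr rfl fun i _ => ?_
  rw [sum_comm]
  refine sum_congr rfl fun j _ => ?_
  rw [← I.sum_E_E, sum_mul, I.d_comm]

end ImmersionCalculus
end Immersion

section ImmersionInvariants

open Matrix

namespace TangentialCalculus

variable {k R ι : Type*} [CommRing k] [CommRing R] [Algebra k R] [Fintype ι]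
  (C : TangentialCalculus k R ι)

lemma W_eq (α γ : ι) : C.W α γ = C.D γ (C.H α) - ∑ κ, C.T α κ * C.D γ (C.H κ) := by
  have h : ∑ κ, C.T α κ * C.D γ (C.H κ) = - ∑ ε, C.a ε γ α * C.H ε := by
    simp only [H, map_sum, mul_sum]
    rw [sum_comm]
    simp only [C.T_Da_fst]
    rw [sum_neg_distrib, sum_comm]
  rw [W, h, sub_neg_eq_add]

/-- The tangential gradient of the projector measures the second fundamental form. -/
lemma sum_D_T_sq : ∑ γ, ∑ α, ∑ β, C.D γ (C.T α β) ^ 2 = 2 * C.S := by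
  have h : ∀ γ α, ∑ β, C.D γ (C.T α β) ^ 2 =
      ∑ β, C.a α γ β * C.a α γ β + ∑ β, C.a β γ α * C.a β γ α := by
    intro γ α
    have h0 := C.a_trd_a_fst α γ γ α
    calc _ = ∑ β, C.a α γ β * C.a α γ β + ∑ β, C.a β γ α * C.a β γ α
            + 2 * ∑ β, C.a α γ β * C.a β γ α := by
          rw [mul_sum, ← sum_add_distrib, ← sum_add_distrib]
          exact sum_congr rfl fun β _ => by rw [C.D_T]; ring
      _ = _ := by rw [h0, mul_zero, add_zero]
  simp only [h, sum_add_distrib, S]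
  rw [two_mul]
  congr 1
  · rw [sum_comm]
  · rw [sum_congr rfl fun γ _ => sum_comm, sum_comm]

end TangentialCalculus

namespace ImmersionCalculus

variable {k R ι ν : Type*} [CommRing k] [CommRing R] [Algebra k R]
    [Fintype ι] [Fintype ν] [DecidableEq ι] [DecidableEq ν] (I : ImmersionCalculus k R ι ν)

lemma gi_symm (i j : ι) : I.gi i j = I.gi j i := by
  rw [← sum_E_E, ← sum_E_E]
  exact sum_congr rfl fun _ _ => mul_comm _ _

/-- Contracting an ambient index of two tangential vectors. -/
lemma sum_E_mul_sum_E (X Y : ι → R) :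
    ∑ β, (∑ i, I.E i β * X i) * (∑ i, I.E i β * Y i) = ∑ i, ∑ i', I.gi i i' * (X i * Y i') := by
  simp only [sum_mul_sum]
  simp only [← sum_E_E, sum_mul]
  rw [sum_comm]
  refine sum_congr rfl fun _ _ => ?_
  rw [sum_comm]
  exact sum_congr rfl fun _ _ => sum_congr rfl fun _ _ => by ring

lemma a_eq' (α β γ : ν) : I.a α β γ = ∑ i, I.E i β * ∑ j, I.E j γ * I.A i α j := by
  simp only [a_eq, mul_sum, mul_assoc]

lemma sum_a_a (α μ : ν) : ∑ β, ∑ γ, I.a α β γ * I.a μ β γ =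
    ∑ i, ∑ i', ∑ j, ∑ j', I.gi i i' * I.gi j j' * (I.A i α j * I.A i' μ j') := by
  rw [sum_comm]
  simp only [a_eq', sum_E_mul_sum_E]
  rw [sum_comm]
  refine sum_congr rfl fun i _ => ?_
  rw [sum_comm]
  refine sum_congr rfl fun i' _ => ?_
  rw [← mul_sum, sum_E_mul_sum_E]
  simp only [mul_sum, mul_assoc]

lemma sum_a_a_eq (α μ : ν) : ∑ β, ∑ γ, I.a α β γ * I.a μ β γ =
    ∑ i, ∑ j, (∑ k, I.gi i k * I.A k α j) * (∑ p, I.gi j p * I.A p μ i) := by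
  rw [sum_a_a, sum_comm]
  refine sum_congr rfl fun i _ => ?_
  rw [sum_comm]
  refine sum_congr rfl fun j _ => ?_
  rw [sum_mul_sum]
  refine sum_congr rfl fun i' _ => sum_congr rfl fun j' _ => ?_
  rw [I.gi_symm i' i, I.A_symm μ i j']
  ring

/-- Squared norm of the second fundamental form in coordinates. -/
lemma tangential_S : I.tangential.S =
    ∑ α, ∑ i, ∑ j, ∑ i', ∑ j', I.gi i i' * I.gi j j' * I.A i α j * I.A i' α j' := by
  have h : I.tangential.S = ∑ α, ∑ β, ∑ γ, I.a α β γ * I.a α β γ := rfl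
  simp only [h, sum_a_a]
  refine sum_congr rfl fun α _ => sum_congr rfl fun i _ => ?_
  rw [sum_comm]
  simp only [mul_assoc]

/-- Mean curvature vector in coordinates. -/
lemma tangential_H (α : ν) : I.tangential.H α = ∑ i, ∑ j, I.gi i j * I.A i α j := by
  have h : I.tangential.H α = ∑ β, I.a α β β := rfl
  simp only [h, a_eq, ← sum_E_E, sum_mul]
  rw [sum_comm]
  exact sum_congr rfl fun _ _ => sum_comm

/-- Normal covariant derivative of the second fundamental form in coordinates. -/
def nablaPerp (l : ι) (α : ν) (i j : ι) : R :=
  I.d l (I.A i α j) - ∑ k, I.Γ k l i * I.A k α j - ∑ k, I.Γ k l j * I.A i α k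
    + ∑ β, ∑ k, ∑ p, I.A i β j * I.gi k p * I.A p β l * I.F α k

lemma sum_gi_F (α : ν) (p : ι) : ∑ k, I.gi k p * I.F α k = I.E p α := by
  have h : (I.F * I.gi) α p = I.E p α := by
    rw [gi, ← Matrix.mul_assoc, show I.F * I.E = I.T from rfl, Matrix.mul_apply]
    exact I.T_E α p
  rw [← h, Matrix.mul_apply]
  exact sum_congr rfl fun _ _ => mul_comm _ _

lemma sum_gi_A_F (α β : ν) (i j l : ι) :
    ∑ k, ∑ p, I.A i β j * I.gi k p * I.A p β l * I.F α k =
      I.A i β j * ∑ p, I.E p α * I.A l β p := by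
  rw [sum_comm, mul_sum]
  refine sum_congr rfl fun p _ => ?_
  rw [← sum_gi_F, sum_mul, mul_sum, I.A_symm β l p]
  exact sum_congr rfl fun _ _ => by ring

lemma D_E_left (δ α β γ : ν) : ∑ i, ∑ j, I.D δ (I.E i β) * I.E j γ * I.A i α j =
    ∑ ε, I.a β δ ε * I.a α ε γ
      - ∑ l, ∑ i, ∑ j, I.E l δ * I.E i β * I.E j γ * ∑ k, I.Γ k l i * I.A k α j := by
  simp only [D_E, sub_mul, sum_sub_distrib, sum_mul, mul_sum]
  congr 1
  · simp only [I.a_eq α, mul_sum]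
    rw [sum_congr rfl fun i _ => sum_comm, sum_comm]
    exact sum_congr rfl fun _ _ => sum_congr rfl fun _ _ => sum_congr rfl fun _ _ => by ring
  · calc _ = ∑ i, ∑ l, ∑ k, ∑ j, I.E l δ * I.E k β * I.Γ i l k * I.E j γ * I.A i α j := by
          refine sum_congr rfl fun i _ => ?_
          rw [sum_comm]
          exact sum_congr rfl fun l _ => sum_comm
      _ = ∑ l, ∑ i, ∑ k, ∑ j, I.E l δ * I.E k β * I.Γ i l k * I.E j γ * I.A i α j := sum_comm
      _ = ∑ l, ∑ k, ∑ i, ∑ j, I.E l δ * I.E k β * I.Γ i l k * I.E j γ * I.A i α j :=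
          sum_congr rfl fun _ _ => sum_comm
      _ = _ := sum_congr rfl fun l _ => sum_congr rfl fun k _ => by
          rw [sum_comm]
          exact sum_congr rfl fun _ _ => sum_congr rfl fun _ _ => by ring

lemma D_E_right (δ α β γ : ν) : ∑ i, ∑ j, I.E i β * I.D δ (I.E j γ) * I.A i α j =
    ∑ ε, I.a γ δ ε * I.a α β ε
      - ∑ l, ∑ i, ∑ j, I.E l δ * I.E i β * I.E j γ * ∑ k, I.Γ k l j * I.A i α k := by
  have h := I.D_E_left δ α γ β
  have h1 : ∀ ε, I.a α ε β = I.a α β ε := fun ε => I.tangential.a_symm α ε β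
  simp only [h1] at h
  calc _ = ∑ j, ∑ i, I.D δ (I.E j γ) * I.E i β * I.A j α i := by
        rw [sum_comm]
        exact sum_congr rfl fun j _ => sum_congr rfl fun i _ => by rw [I.A_symm α j i]; ring
    _ = _ := h
    _ = _ := by
      congr 1
      refine sum_congr rfl fun l _ => ?_
      rw [sum_comm]
      refine sum_congr rfl fun i _ => sum_congr rfl fun j _ => ?_
      simp only [I.A_symm α _ i]
      ring

lemma tangential_c (δ α β γ : ν) : I.tangential.c δ α β γ =
    ∑ l, ∑ i, ∑ j, I.E l δ * I.E i β * I.E j γ * I.nablaPerp l α i j := by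
  have h : I.tangential.c δ α β γ = I.D δ (I.a α β γ) + ∑ ε, I.a ε δ α * I.a ε β γ
    - ∑ ε, I.a β δ ε * I.a α ε γ - ∑ ε, I.a γ δ ε * I.a α β ε := rfl
  have h1 : I.D δ (I.a α β γ) = ∑ i, ∑ j, I.D δ (I.E i β) * I.E j γ * I.A i α j
      + ∑ i, ∑ j, I.E i β * I.D δ (I.E j γ) * I.A i α j
      + ∑ l, ∑ i, ∑ j, I.E l δ * I.E i β * I.E j γ * I.d l (I.A i α j) := by
    have h3 : ∑ l, ∑ i, ∑ j, I.E l δ * I.E i β * I.E j γ * I.d l (I.A i α j) =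
        ∑ i, ∑ j, I.E i β * I.E j γ * I.D δ (I.A i α j) := by
      rw [sum_comm]
      refine sum_congr rfl fun i _ => ?_
      rw [sum_comm]
      refine sum_congr rfl fun j _ => ?_
      rw [D_apply, mul_sum]
      exact sum_congr rfl fun _ _ => by ring
    rw [h3, I.a_eq]
    simp only [map_sum, ← sum_add_distrib]
    refine sum_congr rfl fun i _ => sum_congr rfl fun j _ => ?_
    simp only [Derivation.leibniz, smul_eq_mul]
    ring
  have h2 : ∑ ε, I.a ε δ α * I.a ε β γ = ∑ l, ∑ i, ∑ j, I.E l δ * I.E i β * I.E j γ *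
      ∑ ε, ∑ k, ∑ p, I.A i ε j * I.gi k p * I.A p ε l * I.F α k := by
    simp only [sum_gi_A_F]
    calc _ = ∑ ε, ∑ l, ∑ i, ∑ j, I.E l δ * I.E i β * I.E j γ *
          (I.A i ε j * ∑ p, I.E p α * I.A l ε p) := by
          refine sum_congr rfl fun ε _ => ?_
          rw [a_eq', a_eq, sum_mul]
          refine sum_congr rfl fun l _ => ?_
          rw [mul_sum]
          refine sum_congr rfl fun i _ => ?_
          rw [mul_sum]
          exact sum_congr rfl fun j _ => by ring
      _ = _ := by
          rw [sum_comm]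
          refine sum_congr rfl fun l _ => ?_
          rw [sum_comm]
          refine sum_congr rfl fun i _ => ?_
          rw [sum_comm]
          exact sum_congr rfl fun j _ => by rw [mul_sum]
  rw [h, h1, h2, D_E_left, D_E_right]
  simp only [nablaPerp, mul_add, mul_sub, sum_add_distrib, sum_sub_distrib]
  ring

/-- Squared norm of the normal covariant derivative in coordinates. -/
lemma sum_c_c : ∑ δ, ∑ α, ∑ β, ∑ γ, I.tangential.c δ α β γ * I.tangential.c δ α β γ =
    ∑ α, ∑ l, ∑ l', ∑ i, ∑ i', ∑ j, ∑ j', I.gi l l' * I.gi i i' * I.gi j j'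
      * I.nablaPerp l α i j * I.nablaPerp l' α i' j' := by
  have h : ∀ δ α β γ, I.tangential.c δ α β γ =
      ∑ l, I.E l δ * ∑ i, I.E i β * ∑ j, I.E j γ * I.nablaPerp l α i j := by
    intro δ α β γ
    simp only [tangential_c, mul_sum, mul_assoc]
  rw [sum_comm]
  refine sum_congr rfl fun α _ => ?_
  calc _ = ∑ β, ∑ γ, ∑ δ, I.tangential.c δ α β γ * I.tangential.c δ α β γ := by
        rw [sum_comm]
        exact sum_congr rfl fun β _ => sum_comm
    _ = ∑ β, ∑ γ, ∑ l, ∑ l', I.gi l l' *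
          ((∑ i, I.E i β * ∑ j, I.E j γ * I.nablaPerp l α i j) *
            (∑ i, I.E i β * ∑ j, I.E j γ * I.nablaPerp l' α i j)) := by
        simp only [h, sum_E_mul_sum_E]
    _ = ∑ l, ∑ l', ∑ γ, ∑ β, I.gi l l' *
          ((∑ i, I.E i β * ∑ j, I.E j γ * I.nablaPerp l α i j) *
            (∑ i, I.E i β * ∑ j, I.E j γ * I.nablaPerp l' α i j)) := by
        rw [sum_congr rfl fun β _ => sum_comm, sum_comm]
        refine sum_congr rfl fun l _ => ?_
        rw [sum_congr rfl fun β _ => sum_comm, sum_comm]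
        exact sum_congr rfl fun l' _ => sum_comm
    _ = _ := by
        refine sum_congr rfl fun l _ => sum_congr rfl fun l' _ => ?_
        simp only [← mul_sum, sum_E_mul_sum_E]
        rw [sum_comm, mul_sum]
        refine sum_congr rfl fun i _ => ?_
        rw [sum_comm, mul_sum]
        refine sum_congr rfl fun i' _ => ?_
        rw [← mul_sum, sum_E_mul_sum_E]
        simp only [mul_sum]
        exact sum_congr rfl fun _ _ => sum_congr rfl fun _ _ => by ring

/-- Normal projector. -/
def N : Matrix ν ν R := 1 - I.T

lemma N_map (i : ι) : I.N.map (I.d i) = - (I.A i * I.E + (I.A i * I.E)ᵀ) := by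
  rw [← T_map]
  ext α β
  by_cases h : α = β <;> simp [N, h]

lemma N_mul_normal_curvature (i j : ι) :
    I.N * (I.N.map (I.d i) * I.N.map (I.d j)) * I.N = (I.A i * I.E) * (I.A j * I.E)ᵀ := by
  have hNs : I.Nᵀ = I.N := by
    rw [N, Matrix.transpose_sub, Matrix.transpose_one]
    congr 1
    exact I.F_mul_E_symm
  have hNK : ∀ l, I.N * (I.A l * I.E) = I.A l * I.E := fun l => by
    rw [N, Matrix.sub_mul, ← Matrix.mul_assoc I.T, T_mul_A]; simp
  have hKN : ∀ l, (I.A l * I.E) * I.N = 0 := fun l => by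
    rw [Matrix.mul_assoc, N, Matrix.mul_sub, E_mul_T]; simp
  have hNKt : ∀ l, I.N * (I.A l * I.E)ᵀ = 0 := fun l => by
    rw [← hNs, ← Matrix.transpose_mul, hKN, Matrix.transpose_zero]
  have hKtN : ∀ l, (I.A l * I.E)ᵀ * I.N = (I.A l * I.E)ᵀ := fun l => by
    conv_lhs => rw [← hNs, ← Matrix.transpose_mul, hNK]
  simp only [N_map]
  calc _ = (I.N * (I.A i * I.E) + I.N * (I.A i * I.E)ᵀ) *
        ((I.A j * I.E) * I.N + (I.A j * I.E)ᵀ * I.N) := by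
        rw [neg_mul_neg, ← Matrix.mul_add, ← Matrix.add_mul]
        simp only [Matrix.mul_assoc]
    _ = _ := by rw [hNK, hNKt, hKN, hKtN, add_zero, zero_add]

/-- A vanishing normal curvature makes the shape operators commute. -/
lemma flat_of_normal_curvature
    (h : ∀ i j, I.N * (I.N.map (I.d i) * I.N.map (I.d j) - I.N.map (I.d j) * I.N.map (I.d i)) * I.N
      = 0) : I.tangential.Flat := by
  have hK : ∀ i j, (I.A i * I.E) * (I.A j * I.E)ᵀ = (I.A j * I.E) * (I.A i * I.E)ᵀ := by
    intro i j
    have := h i j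
    rwa [Matrix.mul_sub, Matrix.sub_mul, N_mul_normal_curvature, N_mul_normal_curvature,
      sub_eq_zero] at this
  have hs : ∀ α ε γ κ, ∑ β, I.a α β γ * I.a ε β κ =
      ∑ i, ∑ j, I.E i γ * I.E j κ * ((I.A i * I.E) * (I.A j * I.E)ᵀ) α ε := by
    intro α ε γ κ
    have h1 : ∀ α β γ, I.a α β γ = ∑ i, I.E i γ * (I.A i * I.E) α β := fun α β γ => by
      rw [show I.a α β γ = I.a α γ β from I.tangential.a_symm α β γ, a]
    simp only [h1, sum_mul_sum]
    simp only [Matrix.mul_apply (N := _ᵀ), Matrix.transpose_apply, mul_sum]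
    rw [sum_comm]
    refine sum_congr rfl fun _ _ => ?_
    rw [sum_comm]
    exact sum_congr rfl fun _ _ => sum_congr rfl fun _ _ => by ring
  intro α ε γ κ
  change ∑ β, I.a α β γ * I.a ε β κ = ∑ β, I.a ε β γ * I.a α β κ
  rw [hs, hs]
  refine sum_congr rfl fun i _ => sum_congr rfl fun j _ => ?_
  congr 1
  calc _ = (I.A j * I.E * (I.A i * I.E)ᵀ) α ε := by rw [hK]
    _ = (I.A j * I.E * (I.A i * I.E)ᵀ)ᵀ ε α := rfl
    _ = _ := by rw [Matrix.transpose_mul, Matrix.transpose_transpose]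

end ImmersionCalculus
end ImmersionInvariants

section SmoothFunctions

/-- The algebra of smooth functions on `ℝ^m`. -/
def smoothAlg (m : ℕ) : Subalgebra ℝ ((Fin m → ℝ) → ℝ) where
  carrier := {f | ContDiff ℝ (⊤ : ℕ∞) f}
  mul_mem' {f g} hf hg := by
    rw [Set.mem_ofPred_eq] at *
    exact hf.mul hg
  add_mem' {f g} hf hg := by
    rw [Set.mem_ofPred_eq] at *
    exact hf.add hg
  algebraMap_mem' c := by
    rw [Set.mem_ofPred_eq]
    exact contDiff_const (c := c)

/-- A smooth function as an element of `smoothAlg`. -/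
def toSmooth {m : ℕ} (f : (Fin m → ℝ) → ℝ) (hf : ContDiff ℝ (⊤ : ℕ∞) f) : smoothAlg m := ⟨f, hf⟩

/-- Evaluation at a point. -/
def evalAt {m : ℕ} (x : Fin m → ℝ) : smoothAlg m →+* ℝ :=
  (Pi.evalRingHom (fun _ => ℝ) x).comp (smoothAlg m).val.toRingHom

lemma evalAt_ext {m : ℕ} {f g : smoothAlg m} (h : ∀ x, evalAt x f = evalAt x g) : f = g :=
  Subtype.ext (funext h)

lemma contDiff_pd {m : ℕ} {f : (Fin m → ℝ) → ℝ} (hf : ContDiff ℝ (⊤ : ℕ∞) f) (i : Fin m) :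
    ContDiff ℝ (⊤ : ℕ∞) (pd f i) :=
  (hf.fderiv_right (m := (⊤ : ℕ∞)) (by simp)).clm_apply contDiff_const

lemma differentiableAt_of_contDiff {m : ℕ} {f : (Fin m → ℝ) → ℝ} (hf : ContDiff ℝ (⊤ : ℕ∞) f)
    (x : Fin m → ℝ) : DifferentiableAt ℝ f x :=
  (hf.differentiable (by simp)).differentiableAt

/-- Coordinate derivations of the algebra of smooth functions. -/
def pdDer {m : ℕ} (i : Fin m) : Derivation ℝ (smoothAlg m) (smoothAlg m) :=
  Derivation.mk'
    { toFun := fun f => toSmooth (pd f i) (contDiff_pd f.2 i)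
      map_add' := fun f g => Subtype.ext <| funext fun x => by
        change pd ((f : (Fin m → ℝ) → ℝ) + (g : (Fin m → ℝ) → ℝ)) i x = pd f i x + pd g i x
        rw [pd, fderiv_add (differentiableAt_of_contDiff f.2 x)
          (differentiableAt_of_contDiff g.2 x)]
        rfl
      map_smul' := fun c f => Subtype.ext <| funext fun x => by
        change pd (c • (f : (Fin m → ℝ) → ℝ)) i x = c * pd f i x
        rw [pd, fderiv_const_smul (differentiableAt_of_contDiff f.2 x)]
        rfl }
    fun f g => Subtype.ext <| funext fun x => by
      change pd ((f : (Fin m → ℝ) → ℝ) * (g : (Fin m → ℝ) → ℝ)) i x =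
        (f : (Fin m → ℝ) → ℝ) x * pd g i x + (g : (Fin m → ℝ) → ℝ) x * pd f i x
      rw [pd, fderiv_mul (differentiableAt_of_contDiff f.2 x)
          (differentiableAt_of_contDiff g.2 x)]
      rfl

lemma evalAt_pdDer {m : ℕ} (i : Fin m) (f : smoothAlg m) (x : Fin m → ℝ) :
    evalAt x (pdDer i f) = pd f i x := rfl

lemma pd_pd_comm {m : ℕ} {f : (Fin m → ℝ) → ℝ} (hf : ContDiff ℝ (⊤ : ℕ∞) f) (i j : Fin m)
    (x : Fin m → ℝ) : pd (pd f j) i x = pd (pd f i) j x := by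
  have h : ∀ v w : Fin m → ℝ, fderiv ℝ (fun y => fderiv ℝ f y w) x v = fderiv ℝ (fderiv ℝ f) x v w := by
    intro v w
    rw [fderiv_clm_apply ((hf.fderiv_right (m := (⊤ : ℕ∞)) (by simp)).differentiable
      (by simp)).differentiableAt (differentiableAt_const _)]
    simp
  have hs : IsSymmSndFDerivAt ℝ f x := hf.contDiffAt.isSymmSndFDerivAt (by
    rw [minSmoothness_of_isRCLikeNormedField]
    exact WithTop.coe_le_coe.2 (le_top (a := (2 : ℕ∞))))
  change fderiv ℝ (fun y => fderiv ℝ f y _) x _ = fderiv ℝ (fun y => fderiv ℝ f y _) x _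
  rw [h, h, hs]

/-- Entries of the inverse of a smooth family of matrices are smooth. -/
lemma contDiffAt_matrix_inv {X : Type*} [NormedAddCommGroup X] [NormedSpace ℝ X] {m : ℕ}
    {G : X → Matrix (Fin m) (Fin m) ℝ} {x : X}
    (hG : ∀ i j, ContDiffAt ℝ (⊤ : ℕ∞) (fun y => G y i j) x) (hdet : (G x).det ≠ 0) (i j : Fin m) :
    ContDiffAt ℝ (⊤ : ℕ∞) (fun y => (G y)⁻¹ i j) x := by
  have hd : ∀ G : X → Matrix (Fin m) (Fin m) ℝ,
      (∀ i j, ContDiffAt ℝ (⊤ : ℕ∞) (fun y => G y i j) x) →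
      ContDiffAt ℝ (⊤ : ℕ∞) (fun y => (G y).det) x := by
    intro G hG
    simp only [Matrix.det_apply']
    exact ContDiffAt.sum fun σ _ => contDiffAt_const.mul (contDiffAt_prod fun k _ => hG _ _)
  simp only [Matrix.inv_def, Matrix.smul_apply, Ring.inverse_eq_inv', smul_eq_mul,
    Matrix.adjugate_apply]
  refine ((hd G hG).inv hdet).mul (hd _ fun k l => ?_)
  simp only [Matrix.updateRow_apply]
  split_ifs
  · exact contDiffAt_const
  · exact hG k l

end SmoothFunctions

section CoordinateImmersion

variable {m n : ℕ} {u : (Fin m → ℝ) → (Fin n → ℝ)}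

lemma contDiff_component (hu : ContDiff ℝ (⊤ : ℕ∞) u) (α : Fin n) :
    ContDiff ℝ (⊤ : ℕ∞) (fun y => u y α) := contDiff_pi.1 hu α

lemma contDiff_Fd (hu : ContDiff ℝ (⊤ : ℕ∞) u) (α : Fin n) (i : Fin m) :
    ContDiff ℝ (⊤ : ℕ∞) (Fd u α i) := contDiff_pd (contDiff_component hu α) i

lemma contDiff_gInv (hu : ContDiff ℝ (⊤ : ℕ∞) u) (hdet : ∀ x, (gMat u x).det ≠ 0) (i j : Fin m) :
    ContDiff ℝ (⊤ : ℕ∞) (gInv u i j) :=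
  contDiff_iff_contDiffAt.2 fun x => contDiffAt_matrix_inv (G := gMat u)
    (fun i j => ContDiffAt.sum (s := univ) fun α _ =>
      (contDiff_Fd hu α i).contDiffAt.mul (contDiff_Fd hu α j).contDiffAt) (hdet x) i j

lemma gMat_symm (u : (Fin m → ℝ) → (Fin n → ℝ)) (x : Fin m → ℝ) :
    (gMat u x).transpose = gMat u x := by
  ext i j
  exact sum_congr (s₁ := univ) rfl fun α _ => mul_comm (Fd u α j x) (Fd u α i x)

lemma gInv_symm (u : (Fin m → ℝ) → (Fin n → ℝ)) (x : Fin m → ℝ) (i j : Fin m) :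
    gInv u i j x = gInv u j i x := by
  change (gMat u x)⁻¹ i j = (gMat u x)⁻¹ j i
  rw [← Matrix.transpose_apply (gMat u x)⁻¹, Matrix.transpose_nonsing_inv, gMat_symm]

lemma sum_gInv_gInd {x : Fin m → ℝ} (hdet : (gMat u x).det ≠ 0) (i j : Fin m) :
    ∑ k, gInv u i k x * gInd u k j x = if i = j then 1 else 0 := by
  have := Matrix.nonsing_inv_mul (gMat u x) (isUnit_iff_ne_zero.2 hdet)
  rw [← Matrix.one_apply, ← this, Matrix.mul_apply]
  rfl

/-- The pseudo-inverse of the differential. -/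
def pinv (u : (Fin m → ℝ) → (Fin n → ℝ)) (i : Fin m) (β : Fin n) (x : Fin m → ℝ) : ℝ :=
  ∑ j, gInv u i j x * Fd u β j x

lemma contDiff_pinv (hu : ContDiff ℝ (⊤ : ℕ∞) u) (hdet : ∀ x, (gMat u x).det ≠ 0) (i : Fin m)
    (β : Fin n) : ContDiff ℝ (⊤ : ℕ∞) (pinv u i β) :=
  ContDiff.sum fun j _ => (contDiff_gInv hu hdet i j).mul (contDiff_Fd hu β j)

lemma sum_pinv_Fd {x : Fin m → ℝ} (hdet : (gMat u x).det ≠ 0) (i j : Fin m) :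
    ∑ β, pinv u i β x * Fd u β j x = if i = j then 1 else 0 := by
  rw [← sum_gInv_gInd hdet]
  simp only [pinv, sum_mul, gInd, mul_sum, mul_assoc]
  exact sum_comm

lemma sum_Fd_pinv (u : (Fin m → ℝ) → (Fin n → ℝ)) (α β : Fin n) (x : Fin m → ℝ) :
    ∑ i, Fd u α i x * pinv u i β x = tanP u α β x := by
  simp only [pinv, tanP, mul_sum]
  exact sum_congr rfl fun _ _ => sum_congr rfl fun _ _ => by ring

lemma tanP_symm (u : (Fin m → ℝ) → (Fin n → ℝ)) (α β : Fin n) (x : Fin m → ℝ) :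
    tanP u α β x = tanP u β α x := by
  simp only [tanP]
  rw [sum_comm]
  refine sum_congr rfl fun i _ => sum_congr rfl fun j _ => ?_
  rw [gInv_symm]
  ring

lemma evalAt_mul_apply {κ μ lam : Type*} [Fintype κ] (M : Matrix μ κ (smoothAlg m))
    (N : Matrix κ lam (smoothAlg m)) (i : μ) (j : lam) (x : Fin m → ℝ) :
    evalAt x ((M * N) i j) = ∑ k, evalAt x (M i k) * evalAt x (N k j) := by
  simp only [Matrix.mul_apply, map_sum, map_mul]

/-- The algebraic data of a smooth immersion of `ℝ^m`. -/
def immersion (hu : ContDiff ℝ (⊤ : ℕ∞) u) (hdet : ∀ x, (gMat u x).det ≠ 0) :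
    ImmersionCalculus ℝ (smoothAlg m) (Fin m) (Fin n) where
  d := pdDer
  F := Matrix.of fun α j => toSmooth (Fd u α j) (contDiff_Fd hu α j)
  E := Matrix.of fun i β => toSmooth (pinv u i β) (contDiff_pinv hu hdet i β)
  d_comm i j f := evalAt_ext fun x => pd_pd_comm f.2 i j x
  E_mul_F := by
    ext1 i j
    refine evalAt_ext fun x => ?_
    rw [evalAt_mul_apply, Matrix.one_apply, apply_ite (evalAt x), map_one, map_zero,
      ← sum_pinv_Fd (hdet x)]
    rfl
  F_mul_E_symm := by
    ext1 α β
    refine evalAt_ext fun x => ?_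
    rw [Matrix.transpose_apply, evalAt_mul_apply, evalAt_mul_apply]
    exact (sum_Fd_pinv u β α x).trans ((tanP_symm u β α x).trans (sum_Fd_pinv u α β x).symm)
  d_F i j α := evalAt_ext fun x => pd_pd_comm (contDiff_component hu α) i j x

end CoordinateImmersion

section CoordinateEvaluation

namespace ImmersionCalculus

variable {k R ι ν : Type*} [CommRing k] [CommRing R] [Algebra k R]
    [Fintype ι] [Fintype ν] [DecidableEq ι] [DecidableEq ν] (I : ImmersionCalculus k R ι ν)

/-- Koszul formula for the induced metric. -/
lemma koszul (l q j : ι) : I.d l (∑ α, I.F α q * I.F α j) + I.d j (∑ α, I.F α q * I.F α l)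
    - I.d q (∑ α, I.F α l * I.F α j) = 2 * ∑ α, I.F α q * I.d l (I.F α j) := by
  simp only [map_sum, mul_sum, ← sum_add_distrib, ← sum_sub_distrib, Derivation.leibniz,
    smul_eq_mul]
  refine sum_congr rfl fun α _ => ?_
  rw [I.d_F l q, I.d_F j q, I.d_F j l]
  ring

end ImmersionCalculus

variable {m n : ℕ} {u : (Fin m → ℝ) → (Fin n → ℝ)}

lemma pd_eq_evalAt {f : smoothAlg m} {φ : (Fin m → ℝ) → ℝ} (h : ∀ x, evalAt x f = φ x)
    (l : Fin m) (x : Fin m → ℝ) : pd φ l x = evalAt x (pdDer l f) := by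
  rw [evalAt_pdDer, ← funext h]
  rfl

variable (hu : ContDiff ℝ (⊤ : ℕ∞) u) (hdet : ∀ x, (gMat u x).det ≠ 0)

lemma evalAt_F (α : Fin n) (j : Fin m) (x : Fin m → ℝ) :
    evalAt x ((immersion hu hdet).F α j) = Fd u α j x := rfl

lemma evalAt_E (i : Fin m) (β : Fin n) (x : Fin m → ℝ) :
    evalAt x ((immersion hu hdet).E i β) = pinv u i β x := rfl

lemma evalAt_T (α β : Fin n) (x : Fin m → ℝ) :
    evalAt x ((immersion hu hdet).T α β) = tanP u α β x := by
  rw [ImmersionCalculus.T, evalAt_mul_apply, ← sum_Fd_pinv]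
  rfl

lemma evalAt_d (i : Fin m) (f : smoothAlg m) (x : Fin m → ℝ) :
    evalAt x ((immersion hu hdet).d i f) = evalAt x (pdDer i f) := rfl

lemma evalAt_gi (i j : Fin m) (x : Fin m → ℝ) :
    evalAt x ((immersion hu hdet).gi i j) = gInv u i j x := by
  rw [← ImmersionCalculus.sum_E_E, map_sum, gInv_symm]
  simp only [map_mul, evalAt_E]
  calc _ = ∑ l, gInv u j l x * ∑ β, pinv u i β x * Fd u β l x := by
        simp only [mul_sum]
        rw [sum_comm]
        refine sum_congr rfl fun β _ => ?_
        rw [show pinv u j β x = ∑ l, gInv u j l x * Fd u β l x from rfl, mul_sum]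
        exact sum_congr rfl fun _ _ => by ring
    _ = _ := by simp [sum_pinv_Fd (hdet x)]

lemma evalAt_Γ (p l j : Fin m) (x : Fin m → ℝ) :
    evalAt x ((immersion hu hdet).Γ p l j) = chr u p l j x := by
  have hg : ∀ q j y, evalAt y (∑ α, (immersion hu hdet).F α q * (immersion hu hdet).F α j) =
      gInd u q j y := fun q j y => by
    simp only [map_sum, map_mul, evalAt_F]
    rfl
  have h : ∀ q, pd (gInd u q j) l x + pd (gInd u q l) j x - pd (gInd u l j) q x =
      2 * ∑ α, Fd u α q x * pd (Fd u α j) l x := fun q => by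
    rw [pd_eq_evalAt (hg q j), pd_eq_evalAt (hg q l), pd_eq_evalAt (hg l j), ← map_add, ← map_sub]
    refine (congrArg (evalAt x) ((immersion hu hdet).koszul l q j)).trans ?_
    simp only [map_mul, map_sum, map_ofNat]
    rfl
  simp only [chr, h]
  rw [ImmersionCalculus.Γ, evalAt_mul_apply]
  simp only [evalAt_E, pinv, mul_sum, sum_mul]
  rw [sum_comm]
  refine sum_congr rfl fun q _ => sum_congr rfl fun α _ => ?_
  rw [show evalAt x ((immersion hu hdet).dF l α j) = pd (Fd u α j) l x from rfl]
  ring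

lemma evalAt_A (l : Fin m) (α : Fin n) (j : Fin m) (x : Fin m → ℝ) :
    evalAt x ((immersion hu hdet).A l α j) = sff u α l j x := by
  rw [ImmersionCalculus.A_apply, map_sub, map_sum]
  simp only [map_mul, evalAt_Γ, evalAt_F, sff]
  rfl

lemma evalAt_H (α : Fin n) (x : Fin m → ℝ) :
    evalAt x ((immersion hu hdet).tangential.H α) = mcv u α x := by
  rw [ImmersionCalculus.tangential_H]
  simp only [map_sum, map_mul, evalAt_gi, evalAt_A, mcv]

lemma evalAt_S (x : Fin m → ℝ) :
    evalAt x ((immersion hu hdet).tangential.S) = normA2 u x := by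
  rw [ImmersionCalculus.tangential_S]
  simp only [map_sum, map_mul, evalAt_gi, evalAt_A, normA2]

lemma evalAt_nablaPerp (l : Fin m) (α : Fin n) (i j : Fin m) (x : Fin m → ℝ) :
    evalAt x ((immersion hu hdet).nablaPerp l α i j) = nperpA u l α i j x := by
  simp only [ImmersionCalculus.nablaPerp, nperpA, covA, map_add, map_sub, map_sum, map_mul,
    evalAt_gi, evalAt_A, evalAt_Γ, evalAt_F, evalAt_d, pd_eq_evalAt (evalAt_A hu hdet i α j)]

lemma evalAt_sum_c_c (x : Fin m → ℝ) :
    evalAt x (∑ δ, ∑ α, ∑ β, ∑ γ, (immersion hu hdet).tangential.c δ α β γ *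
      (immersion hu hdet).tangential.c δ α β γ) = normNperpA2 u x := by
  rw [ImmersionCalculus.sum_c_c]
  simp only [map_sum, map_mul, evalAt_gi, evalAt_nablaPerp, normNperpA2]

lemma evalAt_sum_a_a (α μ : Fin n) (x : Fin m → ℝ) :
    evalAt x (∑ β, ∑ γ, (immersion hu hdet).a α β γ * (immersion hu hdet).a μ β γ) =
      ssf u α μ x := by
  rw [ImmersionCalculus.sum_a_a_eq]
  simp only [map_sum, map_mul, evalAt_gi, evalAt_A, ssf]

lemma evalAt_laplacian {f : smoothAlg m} {φ : (Fin m → ℝ) → ℝ} (h : ∀ x, evalAt x f = φ x)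
    (x : Fin m → ℝ) :
    evalAt x (∑ δ, (immersion hu hdet).D δ ((immersion hu hdet).D δ f)) = lapBel u φ x := by
  rw [ImmersionCalculus.laplacian]
  have h2 : ∀ i y, evalAt y (pdDer i f) = pd φ i y := fun i y => (pd_eq_evalAt h i y).symm
  have h3 : ∀ i j, pd (fun y => pd φ i y) j x = evalAt x (pdDer j (pdDer i f)) := fun i j =>
    pd_eq_evalAt (h2 i) j x
  simp only [map_sum, map_mul, map_sub, evalAt_gi, evalAt_Γ, evalAt_d, lapBel, h3, h2]
  rfl

lemma evalAt_N (α β : Fin n) (x : Fin m → ℝ) :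
    evalAt x ((immersion hu hdet).N α β) = norP u α β x := by
  rw [ImmersionCalculus.N, Matrix.sub_apply, map_sub, evalAt_T, Matrix.one_apply,
    apply_ite (evalAt x), map_one, map_zero, norP]

lemma evalAt_normCurv (α β : Fin n) (i j : Fin m) (x : Fin m → ℝ) :
    let I := immersion hu hdet
    evalAt x ((I.N * (I.N.map (I.d i) * I.N.map (I.d j) - I.N.map (I.d j) * I.N.map (I.d i)) * I.N)
      α β) = normCurv u α β i j x := by
  intro I
  have hd : ∀ i γ δ, evalAt x (I.N.map (I.d i) γ δ) = dnorP u i γ δ x := fun i γ δ =>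
    (pd_eq_evalAt (evalAt_N hu hdet γ δ) i x).symm
  have hN : ∀ γ δ, evalAt x (I.N γ δ) = norP u γ δ x := fun γ δ => evalAt_N hu hdet γ δ x
  simp only [evalAt_mul_apply, Matrix.sub_apply, map_sub, hd, hN, normCurv]
  calc _ = ∑ ε, ∑ γ, ∑ δ, norP u α γ x * (dnorP u i γ δ x * dnorP u j δ ε x
        - dnorP u j γ δ x * dnorP u i δ ε x) * norP u ε β x := by
        simp only [← sum_sub_distrib, mul_sum, sum_mul]
    _ = _ := by
        rw [sum_comm]
        exact sum_congr rfl fun γ _ => sum_comm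

lemma tangential_flat (hflat : ∀ α β i j x, normCurv u α β i j x = 0) :
    (immersion hu hdet).tangential.Flat := by
  refine ImmersionCalculus.flat_of_normal_curvature _ fun i j => ?_
  ext1 α β
  refine evalAt_ext fun x => ?_
  rw [evalAt_normCurv hu hdet, hflat, Matrix.zero_apply, map_zero]

lemma evalAt_D (β : Fin n) (f : smoothAlg m) (x : Fin m → ℝ) :
    evalAt x ((immersion hu hdet).D β f) = ∑ i, pinv u i β x * evalAt x (pdDer i f) := by
  rw [ImmersionCalculus.D_apply, map_sum]
  simp only [map_mul]
  rfl

lemma sum_pd_tanP_sq (hu : ContDiff ℝ (⊤ : ℕ∞) u) (hdet : ∀ x, (gMat u x).det ≠ 0)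
    (x : Fin m → ℝ) :
    ∑ γ, ∑ α, ∑ β, (∑ i, pinv u i γ x * pd (tanP u α β) i x) ^ 2 = 2 * normA2 u x := by
  have h := congrArg (evalAt x) (immersion hu hdet).tangential.sum_D_T_sq
  rw [map_mul, evalAt_S, map_ofNat] at h
  rw [← h]
  simp only [map_sum, map_pow]
  refine sum_congr rfl fun γ _ => sum_congr rfl fun α _ => sum_congr rfl fun β _ => ?_
  congr 1
  refine Eq.trans ?_ (evalAt_D hu hdet γ _ x).symm
  exact sum_congr rfl fun i _ => by
    rw [pd_eq_evalAt (evalAt_T hu hdet α β)]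
    rfl

lemma normSsf2_le (hu : ContDiff ℝ (⊤ : ℕ∞) u) (hdet : ∀ x, (gMat u x).det ≠ 0)
    (x : Fin m → ℝ) : normSsf2 u x ≤ normA2 u x ^ 2 := by
  set a : Fin n → Fin n × Fin n → ℝ := fun α p => evalAt x ((immersion hu hdet).a α p.1 p.2)
  have h1 : ∀ α μ, ssf u α μ x = ∑ p, a α p * a μ p := fun α μ => by
    rw [← evalAt_sum_a_a hu hdet, Fintype.sum_prod_type]
    simp only [map_sum, map_mul, a]
  have h2 : normA2 u x = ∑ α, ∑ p, a α p ^ 2 := by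
    rw [← evalAt_S hu hdet]
    have : (immersion hu hdet).tangential.S = ∑ α, ∑ β, ∑ γ,
      (immersion hu hdet).a α β γ * (immersion hu hdet).a α β γ := rfl
    rw [this]
    simp only [map_sum, map_mul, a, Fintype.sum_prod_type, sq]
  rw [normSsf2, h2, sq, sum_mul_sum]
  refine sum_le_sum fun α _ => sum_le_sum fun μ _ => ?_
  rw [h1]
  exact sum_mul_sq_le_sq_mul_sq _ _ _

end CoordinateEvaluation

section JointSmoothness

variable {m n : ℕ}

/-- Smoothness of a time-dependent function near a point of space-time. -/
def JointSmoothAt (f : ℝ → (Fin m → ℝ) → ℝ) (t : ℝ) (x : Fin m → ℝ) : Prop :=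
  ContDiffAt ℝ (⊤ : ℕ∞) (fun p : ℝ × (Fin m → ℝ) => f p.1 p.2) (t, x)

lemma JointSmoothAt.sum {κ : Type*} {s : Finset κ} {f : κ → ℝ → (Fin m → ℝ) → ℝ} {t : ℝ}
    {x : Fin m → ℝ} (h : ∀ k, JointSmoothAt (f k) t x) :
    JointSmoothAt (fun τ y => ∑ k ∈ s, f k τ y) t x :=
  ContDiffAt.sum fun k _ => h k

lemma JointSmoothAt.mul {f g : ℝ → (Fin m → ℝ) → ℝ} {t : ℝ} {x : Fin m → ℝ}
    (hf : JointSmoothAt f t x) (hg : JointSmoothAt g t x) :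
    JointSmoothAt (fun τ y => f τ y * g τ y) t x :=
  ContDiffAt.mul hf hg

lemma JointSmoothAt.add {f g : ℝ → (Fin m → ℝ) → ℝ} {t : ℝ} {x : Fin m → ℝ}
    (hf : JointSmoothAt f t x) (hg : JointSmoothAt g t x) :
    JointSmoothAt (fun τ y => f τ y + g τ y) t x :=
  ContDiffAt.add hf hg

lemma JointSmoothAt.sub {f g : ℝ → (Fin m → ℝ) → ℝ} {t : ℝ} {x : Fin m → ℝ}
    (hf : JointSmoothAt f t x) (hg : JointSmoothAt g t x) :
    JointSmoothAt (fun τ y => f τ y - g τ y) t x :=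
  ContDiffAt.sub hf hg

lemma JointSmoothAt.differentiableAt {f : ℝ → (Fin m → ℝ) → ℝ} {t : ℝ} {x : Fin m → ℝ}
    (hf : JointSmoothAt f t x) : DifferentiableAt ℝ (fun s => f s x) t :=
  DifferentiableAt.comp (f := fun s : ℝ => (s, x)) t (ContDiffAt.differentiableAt hf (by simp))
    (differentiableAt_id.prodMk (differentiableAt_const x))

lemma pd_eq_fderiv_prod {f : ℝ → (Fin m → ℝ) → ℝ} {t : ℝ} {x : Fin m → ℝ} (i : Fin m)
    (h : DifferentiableAt ℝ (fun p : ℝ × (Fin m → ℝ) => f p.1 p.2) (t, x)) :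
    pd (f t) i x = fderiv ℝ (fun p : ℝ × (Fin m → ℝ) => f p.1 p.2) (t, x) (0, Pi.single i 1) := by
  have hc : HasFDerivAt (fun y : Fin m → ℝ => (t, y))
      ((0 : (Fin m → ℝ) →L[ℝ] ℝ).prod (ContinuousLinearMap.id ℝ (Fin m → ℝ))) x :=
    (hasFDerivAt_const t x).prodMk (hasFDerivAt_id x)
  have h2 := HasFDerivAt.comp (f := fun y : Fin m → ℝ => (t, y)) x h.hasFDerivAt hc
  rw [pd, show f t = (fun p : ℝ × (Fin m → ℝ) => f p.1 p.2) ∘ (fun y => (t, y)) from rfl, h2.fderiv]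
  rfl

lemma deriv_eq_fderiv_prod {f : ℝ → (Fin m → ℝ) → ℝ} {t : ℝ} {x : Fin m → ℝ}
    (h : DifferentiableAt ℝ (fun p : ℝ × (Fin m → ℝ) => f p.1 p.2) (t, x)) :
    deriv (fun s => f s x) t = fderiv ℝ (fun p : ℝ × (Fin m → ℝ) => f p.1 p.2) (t, x) (1, 0) := by
  have hc : HasDerivAt (fun s : ℝ => (s, x)) (1, 0) t :=
    (hasDerivAt_id t).prodMk (hasDerivAt_const t x)
  exact (HasFDerivAt.comp_hasDerivAt (f := fun s : ℝ => (s, x)) t h.hasFDerivAt hc).deriv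

lemma JointSmoothAt.eventually_differentiableAt {f : ℝ → (Fin m → ℝ) → ℝ} {t : ℝ} {x : Fin m → ℝ}
    (hf : JointSmoothAt f t x) : ∀ᶠ p in nhds (t, x),
      DifferentiableAt ℝ (fun p : ℝ × (Fin m → ℝ) => f p.1 p.2) p := by
  have h1 : ContDiffAt ℝ 1 (fun p : ℝ × (Fin m → ℝ) => f p.1 p.2) (t, x) :=
    ContDiffAt.of_le hf (by exact WithTop.coe_le_coe.2 (le_top (a := (1 : ℕ∞))))
  filter_upwards [h1.eventually (by simp)] with p hp
  exact hp.differentiableAt (by simp)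

lemma JointSmoothAt.pd {f : ℝ → (Fin m → ℝ) → ℝ} {t : ℝ} {x : Fin m → ℝ}
    (hf : JointSmoothAt f t x) (i : Fin m) : JointSmoothAt (fun s y => pd (f s) i y) t x := by
  have h : ContDiffAt ℝ (⊤ : ℕ∞) (fun p : ℝ × (Fin m → ℝ) =>
      fderiv ℝ (fun p : ℝ × (Fin m → ℝ) => f p.1 p.2) p (0, Pi.single i 1)) (t, x) :=
    (ContDiffAt.fderiv_right (m := (⊤ : ℕ∞)) hf (by simp)).clm_apply contDiffAt_const
  refine h.congr_of_eventuallyEq ?_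
  filter_upwards [hf.eventually_differentiableAt] with p hp
  exact pd_eq_fderiv_prod i hp

/-- Time and space derivatives commute. -/
lemma JointSmoothAt.deriv_pd {f : ℝ → (Fin m → ℝ) → ℝ} {t : ℝ} {x : Fin m → ℝ}
    (hf : JointSmoothAt f t x) (i : Fin m) :
    deriv (fun s => _root_.pd (f s) i x) t =
      _root_.pd (fun y => deriv (fun s => f s y) t) i x := by
  set g : ℝ × (Fin m → ℝ) → ℝ := fun p => f p.1 p.2 with hg
  have hd : DifferentiableAt ℝ (fderiv ℝ g) (t, x) :=
    (ContDiffAt.fderiv_right (m := (⊤ : ℕ∞)) hf (by simp)).differentiableAt (by simp)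
  have hsymm : IsSymmSndFDerivAt ℝ g (t, x) := ContDiffAt.isSymmSndFDerivAt hf (by
    rw [minSmoothness_of_isRCLikeNormedField]
    exact WithTop.coe_le_coe.2 (le_top (a := (2 : ℕ∞))))
  have happ : ∀ v w, fderiv ℝ (fun p => fderiv ℝ g p w) (t, x) v =
      fderiv ℝ (fderiv ℝ g) (t, x) v w := by
    intro v w
    rw [fderiv_clm_apply hd (differentiableAt_const _)]
    simp
  have hdw : ∀ w, DifferentiableAt ℝ (fun p => fderiv ℝ g p w) (t, x) := fun w =>
    hd.clm_apply (differentiableAt_const _)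
  have h1 : deriv (fun s => _root_.pd (f s) i x) t =
      deriv (fun s => (fun s y => fderiv ℝ g (s, y) (0, Pi.single i 1)) s x) t := by
    refine Filter.EventuallyEq.deriv_eq ?_
    have hc : Filter.Tendsto (fun s : ℝ => (s, x)) (nhds t) (nhds (t, x)) :=
      (Continuous.prodMk_left x).continuousAt
    filter_upwards [hc.eventually hf.eventually_differentiableAt] with s hs
    exact pd_eq_fderiv_prod i hs
  have h2 : _root_.pd (fun y => deriv (fun s => f s y) t) i x =
      _root_.pd ((fun s y => fderiv ℝ g (s, y) (1, 0)) t) i x := by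
    refine congrArg (fun L : (Fin m → ℝ) →L[ℝ] ℝ => L (Pi.single i 1)) (Filter.EventuallyEq.fderiv_eq ?_)
    have hc : Filter.Tendsto (fun y : Fin m → ℝ => (t, y)) (nhds x) (nhds (t, x)) :=
      (Continuous.prodMk_right t).continuousAt
    filter_upwards [hc.eventually hf.eventually_differentiableAt] with y hy
    exact deriv_eq_fderiv_prod hy
  rw [h1, h2,
    deriv_eq_fderiv_prod (f := fun s y => fderiv ℝ g (s, y) (0, Pi.single i 1)) (hdw _),
    pd_eq_fderiv_prod (f := fun s y => fderiv ℝ g (s, y) (1, 0)) i (hdw _)]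
  exact ((happ _ _).trans (hsymm _ _)).trans (happ _ _).symm

/-- Two differentiable functions which agree for later times have the same derivative. -/
lemma deriv_eq_of_eqOn_Ico {f g : ℝ → ℝ} {t T : ℝ} (htT : t < T) (hf : DifferentiableAt ℝ f t)
    (hg : DifferentiableAt ℝ g t) (h : ∀ s ∈ Set.Ico t T, f s = g s) : deriv f t = deriv g t := by
  have hu : UniqueDiffWithinAt ℝ (Set.Ico t T) t :=
    (uniqueDiffOn_Ico t T) t ⟨le_rfl, htT⟩
  rw [← hf.derivWithin hu, ← hg.derivWithin hu]
  exact derivWithin_congr h (h t ⟨le_rfl, htT⟩)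

variable {F : ℝ → (Fin m → ℝ) → (Fin n → ℝ)} {t : ℝ} {x : Fin m → ℝ}

lemma jointSmoothAt_Fd (hF : ContDiff ℝ (⊤ : ℕ∞) (fun p : ℝ × (Fin m → ℝ) => F p.1 p.2))
    (α : Fin n) (i : Fin m) : JointSmoothAt (fun s y => Fd (F s) α i y) t x :=
  JointSmoothAt.pd (f := fun s y => F s y α) (contDiff_pi.1 hF α).contDiffAt i

lemma jointSmoothAt_gInd (hF : ContDiff ℝ (⊤ : ℕ∞) (fun p : ℝ × (Fin m → ℝ) => F p.1 p.2))
    (i j : Fin m) : JointSmoothAt (fun s y => gInd (F s) i j y) t x :=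
  JointSmoothAt.sum fun α => (jointSmoothAt_Fd hF α i).mul (jointSmoothAt_Fd hF α j)

lemma jointSmoothAt_gInv (hF : ContDiff ℝ (⊤ : ℕ∞) (fun p : ℝ × (Fin m → ℝ) => F p.1 p.2))
    (hdet : (gMat (F t) x).det ≠ 0) (i j : Fin m) :
    JointSmoothAt (fun s y => gInv (F s) i j y) t x :=
  contDiffAt_matrix_inv (G := fun p : ℝ × (Fin m → ℝ) => gMat (F p.1) p.2)
    (fun i j => jointSmoothAt_gInd hF i j) hdet i j

lemma jointSmoothAt_pinv (hF : ContDiff ℝ (⊤ : ℕ∞) (fun p : ℝ × (Fin m → ℝ) => F p.1 p.2))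
    (hdet : (gMat (F t) x).det ≠ 0) (i : Fin m) (β : Fin n) :
    JointSmoothAt (fun s y => pinv (F s) i β y) t x :=
  JointSmoothAt.sum fun j => (jointSmoothAt_gInv hF hdet i j).mul (jointSmoothAt_Fd hF β j)

lemma jointSmoothAt_tanP (hF : ContDiff ℝ (⊤ : ℕ∞) (fun p : ℝ × (Fin m → ℝ) => F p.1 p.2))
    (hdet : (gMat (F t) x).det ≠ 0) (α β : Fin n) :
    JointSmoothAt (fun s y => tanP (F s) α β y) t x :=
  JointSmoothAt.sum fun i => JointSmoothAt.sum fun j =>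
    ((jointSmoothAt_gInv hF hdet i j).mul (jointSmoothAt_Fd hF α i)).mul (jointSmoothAt_Fd hF β j)

lemma jointSmoothAt_chr (hF : ContDiff ℝ (⊤ : ℕ∞) (fun p : ℝ × (Fin m → ℝ) => F p.1 p.2))
    (hdet : (gMat (F t) x).det ≠ 0) (k i j : Fin m) :
    JointSmoothAt (fun s y => chr (F s) k i j y) t x :=
  JointSmoothAt.mul (f := fun _ _ => 1 / 2) contDiffAt_const <|
    JointSmoothAt.sum fun l => (jointSmoothAt_gInv hF hdet k l).mul <|
      (((jointSmoothAt_gInd hF l j).pd i).add ((jointSmoothAt_gInd hF l i).pd j)).sub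
        ((jointSmoothAt_gInd hF i j).pd l)

lemma jointSmoothAt_sff (hF : ContDiff ℝ (⊤ : ℕ∞) (fun p : ℝ × (Fin m → ℝ) => F p.1 p.2))
    (hdet : (gMat (F t) x).det ≠ 0) (α : Fin n) (i j : Fin m) :
    JointSmoothAt (fun s y => sff (F s) α i j y) t x :=
  ((jointSmoothAt_Fd hF α j).pd i).sub <| JointSmoothAt.sum fun k =>
    (jointSmoothAt_chr hF hdet k i j).mul (jointSmoothAt_Fd hF α k)

lemma jointSmoothAt_normA2 (hF : ContDiff ℝ (⊤ : ℕ∞) (fun p : ℝ × (Fin m → ℝ) => F p.1 p.2))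
    (hdet : (gMat (F t) x).det ≠ 0) : JointSmoothAt (fun s y => normA2 (F s) y) t x :=
  JointSmoothAt.sum fun α => JointSmoothAt.sum fun i => JointSmoothAt.sum fun j =>
    JointSmoothAt.sum fun k => JointSmoothAt.sum fun l =>
      (((jointSmoothAt_gInv hF hdet i k).mul (jointSmoothAt_gInv hF hdet j l)).mul
        (jointSmoothAt_sff hF hdet α i j)).mul (jointSmoothAt_sff hF hdet α k l)

end JointSmoothness

section Flow

variable {m n : ℕ} {F : ℝ → (Fin m → ℝ) → (Fin n → ℝ)} {T t : ℝ}

lemma contDiff_slice (hF : ContDiff ℝ (⊤ : ℕ∞) (fun p : ℝ × (Fin m → ℝ) => F p.1 p.2)) (t : ℝ) :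
    ContDiff ℝ (⊤ : ℕ∞) (F t) :=
  hF.comp (contDiff_const.prodMk contDiff_id)

lemma deriv_Fd (hF : ContDiff ℝ (⊤ : ℕ∞) (fun p : ℝ × (Fin m → ℝ) => F p.1 p.2))
    (hMCF : ∀ x α, deriv (fun s => F s x α) t = mcv (F t) α x)
    (α : Fin n) (j : Fin m) (x : Fin m → ℝ) :
    deriv (fun s => Fd (F s) α j x) t = pd (mcv (F t) α) j x := by
  have h := JointSmoothAt.deriv_pd (f := fun s y => F s y α) (t := t) (x := x)
    (contDiff_pi.1 hF α).contDiffAt j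
  rw [show mcv (F t) α = fun y => deriv (fun s => F s y α) t from
    funext fun y => (hMCF y α).symm]
  exact h

lemma evalAt_D_H {u : (Fin m → ℝ) → (Fin n → ℝ)} (hu : ContDiff ℝ (⊤ : ℕ∞) u)
    (hdet : ∀ x, (gMat u x).det ≠ 0) (κ β : Fin n) (x : Fin m → ℝ) :
    evalAt x ((immersion hu hdet).D β ((immersion hu hdet).tangential.H κ)) =
      ∑ j, pd (mcv u κ) j x * pinv u j β x := by
  rw [evalAt_D]
  exact sum_congr rfl fun j _ => by rw [pd_eq_evalAt (evalAt_H hu hdet κ), mul_comm]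

lemma evalAt_W {u : (Fin m → ℝ) → (Fin n → ℝ)} (hu : ContDiff ℝ (⊤ : ℕ∞) u)
    (hdet : ∀ x, (gMat u x).det ≠ 0) (α β : Fin n) (x : Fin m → ℝ) :
    evalAt x ((immersion hu hdet).tangential.W α β) =
      evalAt x ((immersion hu hdet).D β ((immersion hu hdet).tangential.H α)) -
        ∑ κ, tanP u α κ x * evalAt x ((immersion hu hdet).D β ((immersion hu hdet).tangential.H κ))
      := by
  rw [TangentialCalculus.W_eq, map_sub, map_sum]
  simp only [map_mul]
  congr 1
  exact sum_congr rfl fun κ _ => by rw [← evalAt_T hu hdet]; rfl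

/-- Time derivatives of the differential and of its pseudo-inverse satisfy the linearized
relations of a pseudo-inverse. -/
lemma deriv_pinv_tanP (hF : ContDiff ℝ (⊤ : ℕ∞) (fun p : ℝ × (Fin m → ℝ) => F p.1 p.2))
    (htT : t < T) (himm : ∀ s ∈ Set.Ico t T, ∀ x, (gMat (F s) x).det ≠ 0)
    (hdet : ∀ x, (gMat (F t) x).det ≠ 0)
    (hMCF : ∀ x α, deriv (fun s => F s x α) t = mcv (F t) α x) (x : Fin m → ℝ) :
    let I := immersion (contDiff_slice hF t) hdet
    (∀ i β, deriv (fun s => pinv (F s) i β x) t =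
      evalAt x (∑ κ, I.E i κ * (I.tangential.W β κ - I.D β (I.tangential.H κ)))) ∧
    (∀ α β, deriv (fun s => tanP (F s) α β x) t =
      evalAt x (I.tangential.W α β + I.tangential.W β α)) := by
  intro I
  set Fm : Matrix (Fin n) (Fin m) ℝ := Matrix.of fun α j => Fd (F t) α j x
  set Em : Matrix (Fin m) (Fin n) ℝ := Matrix.of fun i β => pinv (F t) i β x
  set F' : Matrix (Fin n) (Fin m) ℝ := Matrix.of fun α j => deriv (fun s => Fd (F s) α j x) t
    with hF'
  set E' : Matrix (Fin m) (Fin n) ℝ := Matrix.of fun i β => deriv (fun s => pinv (F s) i β x) t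
  have dF : ∀ α j, DifferentiableAt ℝ (fun s => Fd (F s) α j x) t := fun α j =>
    (jointSmoothAt_Fd hF α j).differentiableAt
  have dE : ∀ i β, DifferentiableAt ℝ (fun s => pinv (F s) i β x) t := fun i β =>
    (jointSmoothAt_pinv hF (hdet x) i β).differentiableAt
  have hEF : Em * Fm = 1 := by
    ext i j
    rw [Matrix.mul_apply, Matrix.one_apply, ← sum_pinv_Fd (hdet x)]
    rfl
  have hT : Fm * Em = Matrix.of fun α β => tanP (F t) α β x := by
    ext α β
    rw [Matrix.mul_apply, Matrix.of_apply, ← sum_Fd_pinv]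
    rfl
  have hT' : F' * Em + Fm * E' = Matrix.of fun α β => deriv (fun s => tanP (F s) α β x) t := by
    ext α β
    have h : deriv (fun s => ∑ i, Fd (F s) α i x * pinv (F s) i β x) t =
        ∑ i, (deriv (fun s => Fd (F s) α i x) t * pinv (F t) i β x +
          Fd (F t) α i x * deriv (fun s => pinv (F s) i β x) t) := by
      rw [deriv_fun_sum fun i _ => (dF α i).fun_mul (dE i β)]
      exact sum_congr rfl fun i _ => deriv_fun_mul (dF α i) (dE i β)
    simp only [sum_Fd_pinv, sum_add_distrib] at h
    rw [Matrix.of_apply, h]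
    rfl
  have hs : (Fm * Em).transpose = Fm * Em := by
    rw [hT]
    ext α β
    exact tanP_symm _ _ _ _
  have hs' : (F' * Em + Fm * E').transpose = F' * Em + Fm * E' := by
    rw [hT']
    ext α β
    simp only [Matrix.transpose_apply, Matrix.of_apply, tanP_symm _ α β]
  have h' : E' * Fm + Em * F' = 0 := by
    ext i j
    have h : deriv (fun s => ∑ β, pinv (F s) i β x * Fd (F s) β j x) t =
        ∑ β, (deriv (fun s => pinv (F s) i β x) t * Fd (F t) β j x +
          pinv (F t) i β x * deriv (fun s => Fd (F s) β j x) t) := by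
      rw [deriv_fun_sum fun β _ => (dE i β).fun_mul (dF β j)]
      exact sum_congr rfl fun β _ => deriv_fun_mul (dE i β) (dF β j)
    rw [deriv_eq_of_eqOn_Ico (g := fun _ => if i = j then 1 else 0) htT
      (DifferentiableAt.fun_sum fun β _ => (dE i β).fun_mul (dF β j)) (differentiableAt_const _)
      fun s hs => sum_pinv_Fd (himm s hs x) i j, deriv_const, sum_add_distrib] at h
    exact h.symm
  have hFE : ∀ κ β, (F' * Em) κ β = evalAt x (I.D β (I.tangential.H κ)) := fun κ β => by
    rw [evalAt_D_H, Matrix.mul_apply]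
    simp only [hF', Matrix.of_apply, deriv_Fd hF hMCF]
    rfl
  have hK : ∀ α β, ((1 - Fm * Em) * F' * Em : Matrix (Fin n) (Fin n) ℝ) α β =
      evalAt x (I.tangential.W α β) := fun α β => by
    rw [evalAt_W, Matrix.mul_assoc, Matrix.sub_mul, Matrix.one_mul, Matrix.sub_apply, hFE,
      Matrix.mul_apply, hT]
    simp only [hFE]
    rfl
  refine ⟨fun i β => ?_, fun α β => ?_⟩
  · have h := congrFun (congrFun (deriv_pseudoinverse hEF hs h' hs') i) β
    rw [Matrix.sub_apply, Matrix.mul_assoc Em F' Em, Matrix.mul_apply (M := Em), Matrix.mul_apply (M := Em)] at h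
    simp only [Matrix.transpose_apply, hK, hFE] at h
    refine Eq.trans h ?_
    rw [← sum_sub_distrib, map_sum]
    refine sum_congr rfl fun κ _ => ?_
    rw [map_mul, map_sub, mul_sub]
    rfl
  · have h := congrFun (congrFun (deriv_projector hEF hs h' hs') α) β
    rw [hT', Matrix.add_apply, Matrix.transpose_apply, hK, hK] at h
    rw [map_add]
    exact h

lemma deriv_normA2 (hF : ContDiff ℝ (⊤ : ℕ∞) (fun p : ℝ × (Fin m → ℝ) => F p.1 p.2))
    (htT : t < T) (himm : ∀ s ∈ Set.Ico t T, ∀ x, (gMat (F s) x).det ≠ 0)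
    (hdet : ∀ x, (gMat (F t) x).det ≠ 0)
    (hMCF : ∀ x α, deriv (fun s => F s x α) t = mcv (F t) α x) (x : Fin m → ℝ) :
    let C := (immersion (contDiff_slice hF t) hdet).tangential
    deriv (fun s => normA2 (F s) x) t = evalAt x (2 * ∑ α, ∑ β, ∑ γ, C.a α β γ *
      (∑ κ, (C.W β κ - C.D β (C.H κ)) * C.D κ (C.T α γ) + C.D β (C.W α γ + C.W γ α))) := by
  intro C
  set X : Fin n → Fin n → Fin n → smoothAlg m := fun β α γ =>
    ∑ κ, (C.W β κ - C.D β (C.H κ)) * C.D κ (C.T α γ) + C.D β (C.W α γ + C.W γ α) with hX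
  have dE : ∀ i β, DifferentiableAt ℝ (fun s => pinv (F s) i β x) t := fun i β =>
    (jointSmoothAt_pinv hF (hdet x) i β).differentiableAt
  have dT : ∀ i α β, DifferentiableAt ℝ (fun s => pd (tanP (F s) α β) i x) t := fun i α β =>
    ((jointSmoothAt_tanP hF (hdet x) α β).pd i).differentiableAt
  have dDT : ∀ γ α β, DifferentiableAt ℝ
      (fun s => ∑ i, pinv (F s) i γ x * pd (tanP (F s) α β) i x) t := fun γ α β =>
    DifferentiableAt.fun_sum fun i _ => (dE i γ).fun_mul (dT i α β)
  have hDT : ∀ γ α β, ∑ i, pinv (F t) i γ x * pd (tanP (F t) α β) i x =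
      evalAt x (C.D γ (C.T α β)) := fun γ α β => by
    refine Eq.trans ?_ (evalAt_D (contDiff_slice hF t) hdet γ _ x).symm
    exact sum_congr rfl fun i _ => by
      rw [pd_eq_evalAt (evalAt_T (contDiff_slice hF t) hdet α β)]
      rfl
  have hT' : ∀ i α β, deriv (fun s => pd (tanP (F s) α β) i x) t =
      evalAt x (pdDer i (C.W α β + C.W β α)) := fun i α β => by
    rw [JointSmoothAt.deriv_pd (f := fun s y => tanP (F s) α β y)
      (jointSmoothAt_tanP hF (hdet x) α β)]
    exact pd_eq_evalAt (fun y => ((deriv_pinv_tanP hF htT himm hdet hMCF y).2 α β).symm) i x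
  have hX' : ∀ γ α β, deriv (fun s => ∑ i, pinv (F s) i γ x * pd (tanP (F s) α β) i x) t =
      evalAt x (X γ α β) := by
    intro γ α β
    rw [deriv_fun_sum fun i _ => (dE i γ).fun_mul (dT i α β),
      sum_congr rfl fun i _ => deriv_fun_mul (dE i γ) (dT i α β), sum_add_distrib, hX, map_add]
    congr 1
    · simp only [(deriv_pinv_tanP hF htT himm hdet hMCF x).1, map_sum, map_mul, ← hDT, sum_mul,
        mul_sum, evalAt_E]
      rw [sum_comm]
      refine sum_congr rfl fun κ _ => sum_congr rfl fun i _ => ?_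
      rw [mul_comm (pinv _ _ _ _), mul_assoc]
      rfl
    · simp only [hT']
      exact (evalAt_D (contDiff_slice hF t) hdet γ _ x).symm
  have h1 : deriv (fun s => 2 * normA2 (F s) x) t = deriv (fun s => ∑ γ, ∑ α, ∑ β,
      (∑ i, pinv (F s) i γ x * pd (tanP (F s) α β) i x) ^ 2) t :=
    deriv_eq_of_eqOn_Ico htT
      ((jointSmoothAt_normA2 hF (hdet x)).differentiableAt.const_mul 2)
      (DifferentiableAt.fun_sum fun γ _ => DifferentiableAt.fun_sum fun α _ =>
        DifferentiableAt.fun_sum fun β _ => (dDT γ α β).fun_pow 2)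
      fun s hs => (sum_pd_tanP_sq (contDiff_slice hF s) (himm s hs) x).symm
  have h2 : deriv (fun s => ∑ γ, ∑ α, ∑ β,
      (∑ i, pinv (F s) i γ x * pd (tanP (F s) α β) i x) ^ 2) t =
      evalAt x (∑ γ, ∑ α, ∑ β, 2 * (C.D γ (C.T α β) * X γ α β)) := by
    rw [deriv_fun_sum fun γ _ => DifferentiableAt.fun_sum fun α _ =>
        DifferentiableAt.fun_sum fun β _ => (dDT γ α β).fun_pow 2]
    simp only [map_sum]
    refine sum_congr rfl fun γ _ => ?_
    rw [deriv_fun_sum fun α _ => DifferentiableAt.fun_sum fun β _ => (dDT γ α β).fun_pow 2]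
    refine sum_congr rfl fun α _ => ?_
    rw [deriv_fun_sum fun β _ => (dDT γ α β).fun_pow 2]
    refine sum_congr rfl fun β _ => ?_
    rw [deriv_fun_pow (dDT γ α β), hX', hDT, map_mul, map_mul, map_ofNat]
    norm_num
    ring
  have hXs : ∀ γ α β, X γ α β = X γ β α := fun γ α β => by
    simp only [hX]
    rw [add_comm (C.W α β)]
    simp only [C.T_symm α β]
  have h3 : ∑ γ, ∑ α, ∑ β, 2 * (C.D γ (C.T α β) * X γ α β) =
      2 * (2 * ∑ α, ∑ β, ∑ γ, C.a α β γ * X β α γ) := by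
    have e1 : ∑ γ, ∑ α, ∑ β, C.a α γ β * X γ α β = ∑ α, ∑ β, ∑ γ, C.a α β γ * X β α γ := sum_comm
    have e2 : ∑ γ, ∑ α, ∑ β, C.a β γ α * X γ α β = ∑ α, ∑ β, ∑ γ, C.a α β γ * X β α γ := by
      rw [← e1]
      refine sum_congr rfl fun γ _ => ?_
      rw [sum_comm]
      exact sum_congr rfl fun α _ => sum_congr rfl fun β _ => by rw [hXs]
    simp only [C.D_T, ← mul_sum, add_mul, sum_add_distrib, e1, e2]
    ring
  have h4 := h1.trans h2
  rw [deriv_const_mul _ (jointSmoothAt_normA2 hF (hdet x)).differentiableAt, h3, map_mul,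
    map_ofNat] at h4
  exact mul_left_cancel₀ two_ne_zero h4

end Flow

/-- Under mean curvature flow with flat normal bundle,
`d/dt|A|² = Δ|A|² - 2|∇^⊥A|² + 2|A^{αm}_n A^{βn}_m|² ≤ Δ|A|² - 2|∇^⊥A|² + 2|A|⁴`. -/
theorem secondFundamentalForm_evolution_flat {m n : ℕ}
    (F : ℝ → (Fin m → ℝ) → (Fin n → ℝ)) (T : ℝ) (hT : 0 < T)
    (hF : ContDiff ℝ (⊤ : ℕ∞) (fun p : ℝ × (Fin m → ℝ) => F p.1 p.2))
    (himm : ∀ t ∈ Set.Ico (0 : ℝ) T, ∀ x, (gMat (F t) x).det ≠ 0)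
    (hMCF : ∀ t ∈ Set.Ico (0 : ℝ) T, ∀ x α, deriv (fun s => F s x α) t = mcv (F t) α x)
    (hflat : ∀ t ∈ Set.Ico (0 : ℝ) T, ∀ (α β : Fin n) (i j : Fin m) (x : Fin m → ℝ),
      normCurv (F t) α β i j x = 0) :
    ∀ t ∈ Set.Ico (0 : ℝ) T, ∀ x,
      deriv (fun s => normA2 (F s) x) t =
        lapBel (F t) (normA2 (F t)) x - 2 * normNperpA2 (F t) x + 2 * normSsf2 (F t) x ∧
      deriv (fun s => normA2 (F s) x) t ≤
        lapBel (F t) (normA2 (F t)) x - 2 * normNperpA2 (F t) x + 2 * (normA2 (F t) x) ^ 2 := by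
  intro t ht x
  have hu := contDiff_slice hF t
  have hdet := himm t ht
  have heq : deriv (fun s => normA2 (F s) x) t =
      lapBel (F t) (normA2 (F t)) x - 2 * normNperpA2 (F t) x + 2 * normSsf2 (F t) x := by
    refine (deriv_normA2 hF ht.2 (fun s hs => himm s ⟨ht.1.trans hs.1, hs.2⟩) hdet (hMCF t ht)
      x).trans ?_
    rw [TangentialCalculus.evolution_eq_laplacian _
      (tangential_flat hu hdet fun α β i j y => hflat t ht α β i j y)]
    simp only [map_add, map_sub, map_mul _ (2 : smoothAlg m), map_ofNat]
    congr 1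
    · congr 1
      · exact evalAt_laplacian hu hdet (evalAt_S hu hdet) x
      · exact congrArg (2 * ·) (evalAt_sum_c_c hu hdet x)
    · exact congrArg (2 * ·) <| (map_sum _ _ _).trans <| sum_congr rfl fun α _ =>
        (map_sum _ _ _).trans <| sum_congr rfl fun μ _ =>
          (map_pow (evalAt x) _ 2).trans (congrArg (· ^ 2) (evalAt_sum_a_a hu hdet α μ x))
  refine ⟨heq, ?_⟩
  have hle := normSsf2_le hu hdet x
  linarith

end
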